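/- Let s ∈ ℕ with s ≥ 2, let T₀ > 0, Λ ≥ 1, B ≥ 1 and ε ∈ (0,1]. Let φ_eik ∈ C^∞([0,T₀] × ℝ³; ℝ) with sup_{[0,T₀]×ℝ³} |∂_x^σ φ_eik| ≤ Λ for 2 ≤ |σ| ≤ s + 2. Let K ∈ L¹(ℝ³) with K ≥ 0 and ε⁻¹‖K‖_{L¹} ≤ Λ ε. Let a^ε ∈ C^∞([0,T₀] × ℝ³; ℂ), Schwartz in x, solve the amplitude equation ∂_t a^ε + ∇φ_eik·∇a^ε + (1/2) a^ε Δφ_eik = i(ε/2)Δa^ε − i ε⁻¹ (K ∗ |a^ε|²) a^ε with sup_t ‖a^ε(t)‖_{H^s} ≤ B, and let a ∈ C^∞([0,T₀] × ℝ³; ℂ), Schwartz in x, solve the transport equation ∂_t a + ∇φ_eik·∇a + (1/2) a Δφ_eik = 0 with sup_t ‖a(t)‖_{H^{s+2}} ≤ B. Then there exists C > 0, depending only on s, T₀, Λ and B, such that sup_{t∈[0,T₀]} ‖a^ε(t) − a(t)‖_{H^s} ≤ C (‖a^ε(0) − a(0)‖_{H^s} + ε). (Subcritical/semiclassical Gross–Pitaevskii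 regime κ = 0: the WKB amplitude converges to the free-transport amplitude.) -/

import Mathlib

noncomputable section

open MeasureTheory Real Set

/-- Three-dimensional Euclidean space `ℝ³`. -/
abbrev E3 := EuclideanSpace ℝ (Fin 3)

/-- The `i`-th standard basis vector of `ℝ³`. -/
def e3 (i : Fin 3) : E3 := EuclideanSpace.single i 1

/-- Partial derivative `∂ᵢ` of a complex-valued function on `ℝ³`. -/
def pd (i : Fin 3) (g : E3 → ℂ) : E3 → ℂ := fun x => fderiv ℝ g x (e3 i)

/-- Partial derivative `∂ᵢ` of a real-valued function on `ℝ³`. -/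
def pdR (i : Fin 3) (g : E3 → ℝ) : E3 → ℝ := fun x => fderiv ℝ g x (e3 i)

/-- Multi-index partial derivative `∂^σ` of a complex-valued function. -/
def mpd (σ : Fin 3 → ℕ) (g : E3 → ℂ) : E3 → ℂ :=
  (pd 0)^[σ 0] ((pd 1)^[σ 1] ((pd 2)^[σ 2] g))

/-- Multi-index partial derivative `∂^σ` of a real-valued function. -/
def mpdR (σ : Fin 3 → ℕ) (g : E3 → ℝ) : E3 → ℝ :=
  (pdR 0)^[σ 0] ((pdR 1)^[σ 1] ((pdR 2)^[σ 2] g))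

/-- Degree `|σ|` of a multi-index `σ ∈ ℕ³`. -/
def mdeg (σ : Fin 3 → ℕ) : ℕ := σ 0 + σ 1 + σ 2

/-- The finite set of multi-indices `σ ∈ ℕ³` with `|σ| ≤ s`. -/
def mIdx (s : ℕ) : Finset (Fin 3 → ℕ) :=
  (Fintype.piFinset fun _ : Fin 3 => Finset.range (s + 1)).filter fun σ => mdeg σ ≤ s

/-- Sobolev norm `‖g‖_{H^s}`, `‖g‖_{H^s}² = Σ_{|σ| ≤ s} ‖∂^σ g‖²_{L²}`. -/
def sobNorm (s : ℕ) (g : E3 → ℂ) : ℝ :=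
  Real.sqrt (∑ σ ∈ mIdx s, ∫ x : E3, ‖mpd σ g x‖ ^ 2)

/-- Semiclassical Sobolev norm `‖g‖_{H^s_ε}`,
`‖g‖²_{H^s_ε} = Σ_{|σ| ≤ s} ε^{2|σ|} ‖∂^σ g‖²_{L²}`. -/
def sobNormE (ε : ℝ) (s : ℕ) (g : E3 → ℂ) : ℝ :=
  Real.sqrt (∑ σ ∈ mIdx s, ε ^ (2 * mdeg σ) * ∫ x : E3, ‖mpd σ g x‖ ^ 2)

/-- Laplacian of a complex-valued function on `ℝ³`. -/
def lapC (g : E3 → ℂ) : E3 → ℂ := fun x => ∑ i : Fin 3, pd i (pd i g) x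

/-- Laplacian of a real-valued function on `ℝ³`. -/
def lapR (g : E3 → ℝ) : E3 → ℝ := fun x => ∑ i : Fin 3, pdR i (pdR i g) x

/-- Convolution `(W ∗ g)(x) = ∫ W(x - y) g(y) dy` on `ℝ³`. -/
def conv3 (W g : E3 → ℝ) : E3 → ℝ := fun x => ∫ y : E3, W (x - y) * g y

/-- A function on `ℝ³` of Schwartz class: smooth with all derivatives rapidly decaying. -/
def IsSchwartzF {F : Type*} [NormedAddCommGroup F] [NormedSpace ℝ F] (g : E3 → F) : Prop :=
  (∀ n : ℕ, ContDiff ℝ n g) ∧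
    ∀ k n : ℕ, ∃ C : ℝ, ∀ x : E3, ‖x‖ ^ k * ‖iteratedFDeriv ℝ n g x‖ ≤ C

open scoped ContDiff SchwartzMap LineDeriv FourierTransform

/-- Iterated partial derivative along a word in the coordinate directions. -/
def dl : List (Fin 3) → (E3 → ℂ) → E3 → ℂ
  | [], g => g
  | i :: l, g => pd i (dl l g)

lemma contDiff_pd {g : E3 → ℂ} (hg : ContDiff ℝ ∞ g) (i : Fin 3) : ContDiff ℝ ∞ (pd i g) :=
  (hg.fderiv_right (m := ∞) (by simp)).clm_apply contDiff_const

lemma contDiff_dl {g : E3 → ℂ} (hg : ContDiff ℝ ∞ g) (l : List (Fin 3)) :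
    ContDiff ℝ ∞ (dl l g) := by
  induction l with
  | nil => exact hg
  | cons i l ih => exact contDiff_pd ih i

lemma ContDiff.diffble {g : E3 → ℂ} (hg : ContDiff ℝ ∞ g) : Differentiable ℝ g :=
  hg.differentiable (by simp)

lemma pd_add {f g : E3 → ℂ} (hf : Differentiable ℝ f) (hg : Differentiable ℝ g) (i : Fin 3) :
    pd i (fun x => f x + g x) = fun x => pd i f x + pd i g x := by
  funext x
  simp [pd, fderiv_fun_add (hf x) (hg x)]

lemma pd_sub {f g : E3 → ℂ} (hf : Differentiable ℝ f) (hg : Differentiable ℝ g) (i : Fin 3) :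
    pd i (fun x => f x - g x) = fun x => pd i f x - pd i g x := by
  funext x
  simp [pd, fderiv_fun_sub (hf x) (hg x)]

lemma pd_const_mul {f : E3 → ℂ} (hf : Differentiable ℝ f) (c : ℂ) (i : Fin 3) :
    pd i (fun x => c * f x) = fun x => c * pd i f x := by
  funext x
  simp [pd, fderiv_const_mul (hf x)]

lemma pd_mul {f g : E3 → ℂ} (hf : Differentiable ℝ f) (hg : Differentiable ℝ g) (i : Fin 3) :
    pd i (fun x => f x * g x) = fun x => f x * pd i g x + pd i f x * g x := by
  funext x
  simp [pd, fderiv_fun_mul (hf x) (hg x), mul_comm]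

lemma pd_conj (f : E3 → ℂ) (hf : Differentiable ℝ f) (i : Fin 3) :
    pd i (fun x => (starRingEnd ℂ) (f x)) = fun x => (starRingEnd ℂ) (pd i f x) := by
  funext x
  have h := (Complex.conjCLE.toContinuousLinearMap.hasFDerivAt (x := f x)).comp x
    (hf x).hasFDerivAt
  have h' : HasFDerivAt (fun x => (starRingEnd ℂ) (f x)) _ x := h
  simp [pd, h'.fderiv]

lemma pd_sum {ι : Type*} (S : Finset ι) {f : ι → E3 → ℂ} (hf : ∀ j ∈ S, Differentiable ℝ (f j))
    (i : Fin 3) : pd i (fun x => ∑ j ∈ S, f j x) = fun x => ∑ j ∈ S, pd i (f j) x := by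
  funext x
  simp only [pd]
  rw [fderiv_fun_sum (fun j hj => hf j hj x)]
  simp

lemma pd_comm {g : E3 → ℂ} (hg : ContDiff ℝ ∞ g) (i j : Fin 3) :
    pd i (pd j g) = pd j (pd i g) := by
  funext x
  have hs : IsSymmSndFDerivAt ℝ g x := hg.contDiffAt.isSymmSndFDerivAt
    (by simp only [minSmoothness_of_isRCLikeNormedField]; exact ENat.LEInfty.out)
  have hd : DifferentiableAt ℝ (fderiv ℝ g) x :=
    (hg.fderiv_right (m := ∞) (by simp)).differentiable (by simp) x
  have key : ∀ a b : Fin 3, pd a (pd b g) x = fderiv ℝ (fderiv ℝ g) x (e3 a) (e3 b) := by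
    intro a b
    change fderiv ℝ (fun y => fderiv ℝ g y (e3 b)) x (e3 a) = _
    rw [fderiv_clm_apply hd (differentiableAt_const _)]
    simp
  rw [key, key]
  exact hs _ _

lemma dl_add {f g : E3 → ℂ} (hf : ContDiff ℝ ∞ f) (hg : ContDiff ℝ ∞ g) (l : List (Fin 3)) :
    dl l (fun x => f x + g x) = fun x => dl l f x + dl l g x := by
  induction l with
  | nil => rfl
  | cons i l ih =>
    simp only [dl]
    rw [ih, pd_add (contDiff_dl hf l).diffble (contDiff_dl hg l).diffble]

lemma dl_sub {f g : E3 → ℂ} (hf : ContDiff ℝ ∞ f) (hg : ContDiff ℝ ∞ g) (l : List (Fin 3)) :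
    dl l (fun x => f x - g x) = fun x => dl l f x - dl l g x := by
  induction l with
  | nil => rfl
  | cons i l ih =>
    simp only [dl]
    rw [ih, pd_sub (contDiff_dl hf l).diffble (contDiff_dl hg l).diffble]

lemma dl_const_mul {f : E3 → ℂ} (hf : ContDiff ℝ ∞ f) (c : ℂ) (l : List (Fin 3)) :
    dl l (fun x => c * f x) = fun x => c * dl l f x := by
  induction l with
  | nil => rfl
  | cons i l ih => simp only [dl]; rw [ih, pd_const_mul (contDiff_dl hf l).diffble]

lemma dl_conj {f : E3 → ℂ} (hf : ContDiff ℝ ∞ f) (l : List (Fin 3)) :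
    dl l (fun x => (starRingEnd ℂ) (f x)) = fun x => (starRingEnd ℂ) (dl l f x) := by
  induction l with
  | nil => rfl
  | cons i l ih => simp only [dl]; rw [ih, pd_conj _ (contDiff_dl hf l).diffble]

lemma dl_sum {ι : Type*} (S : Finset ι) {f : ι → E3 → ℂ} (hf : ∀ j, ContDiff ℝ ∞ (f j))
    (l : List (Fin 3)) : dl l (fun x => ∑ j ∈ S, f j x) = fun x => ∑ j ∈ S, dl l (f j) x := by
  induction l with
  | nil => rfl
  | cons i l ih =>
    simp only [dl]; rw [ih, pd_sum S (fun j _ => (contDiff_dl (hf j) l).diffble)]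

lemma dl_append (l l' : List (Fin 3)) (g : E3 → ℂ) : dl (l ++ l') g = dl l (dl l' g) := by
  induction l with
  | nil => rfl
  | cons i l ih => simp only [List.cons_append, dl, ih]

lemma dl_perm {l l' : List (Fin 3)} (h : l.Perm l') {g : E3 → ℂ} (hg : ContDiff ℝ ∞ g) :
    dl l g = dl l' g := by
  induction h with
  | nil => rfl
  | cons i _ ih => simp only [dl, ih]
  | swap i j l => simp only [dl]; exact pd_comm (contDiff_dl hg l) _ _
  | trans _ _ h1 h2 => exact h1.trans h2

lemma dl_replicate (i : Fin 3) (n : ℕ) (g : E3 → ℂ) :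
    dl (List.replicate n i) g = (pd i)^[n] g := by
  induction n with
  | zero => rfl
  | succ n ih => rw [List.replicate_succ, Function.iterate_succ_apply']; simp only [dl, ih]

/-- The sorted word attached to a multi-index. -/
def mword (σ : Fin 3 → ℕ) : List (Fin 3) :=
  List.replicate (σ 0) 0 ++ (List.replicate (σ 1) 1 ++ List.replicate (σ 2) 2)

lemma mpd_eq_dl (σ : Fin 3 → ℕ) (g : E3 → ℂ) : mpd σ g = dl (mword σ) g := by
  simp only [mpd, mword, dl_append, dl_replicate]

lemma length_mword (σ : Fin 3 → ℕ) : (mword σ).length = mdeg σ := by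
  simp [mword, mdeg, add_assoc]

lemma count_mword (σ : Fin 3 → ℕ) (i : Fin 3) : (mword σ).count i = σ i := by
  fin_cases i <;> simp [mword, List.count_replicate]

lemma perm_mword (l : List (Fin 3)) : l.Perm (mword fun i => l.count i) := by
  rw [List.perm_iff_count]
  intro i
  rw [count_mword]

lemma dl_eq_mpd {g : E3 → ℂ} (hg : ContDiff ℝ ∞ g) (l : List (Fin 3)) :
    dl l g = mpd (fun i => l.count i) g := by
  rw [mpd_eq_dl]
  exact dl_perm (perm_mword l) hg

lemma mdeg_count (l : List (Fin 3)) : mdeg (fun i => l.count i) = l.length := by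
  rw [← length_mword]
  exact (perm_mword l).length_eq.symm

lemma mem_mIdx {s : ℕ} {σ : Fin 3 → ℕ} : σ ∈ mIdx s ↔ mdeg σ ≤ s := by
  simp only [mIdx, Finset.mem_filter, Fintype.mem_piFinset, Finset.mem_range]
  refine ⟨fun h => h.2, fun h => ⟨fun i => ?_, h⟩⟩
  unfold mdeg at h
  fin_cases i <;> simp <;> omega

/-- All ways of distributing a word between two factors, except the one where the first factor
receives nothing. -/
def splitsTail : List (Fin 3) → List (List (Fin 3) × List (Fin 3))
  | [] => []
  | i :: l => (splitsTail l).map (fun p => (p.1, i :: p.2)) ++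
      (([], l) :: splitsTail l).map (fun p => (i :: p.1, p.2))

/-- All ways of distributing a word between two factors. -/
def splits (l : List (Fin 3)) : List (List (Fin 3) × List (Fin 3)) := ([], l) :: splitsTail l

lemma splitsTail_length {l : List (Fin 3)} :
    ∀ p ∈ splitsTail l, 1 ≤ p.1.length ∧ p.1.length + p.2.length = l.length := by
  induction l with
  | nil => simp [splitsTail]
  | cons i l ih =>
    intro p hp
    simp only [splitsTail, List.mem_append, List.mem_map, List.mem_cons] at hp
    rcases hp with ⟨q, hq, rfl⟩ | ⟨q, hq, rfl⟩
    · have := ih q hq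
      simp only [List.length_cons]; omega
    · rcases hq with rfl | hq
      · simp; omega
      · have := ih q hq
        simp only [List.length_cons]; omega

lemma splits_length {l : List (Fin 3)} : ∀ p ∈ splits l, p.1.length + p.2.length = l.length := by
  intro p hp
  simp only [splits, List.mem_cons] at hp
  rcases hp with rfl | hp
  · simp
  · exact (splitsTail_length p hp).2

lemma length_splits (l : List (Fin 3)) : (splits l).length = 2 ^ l.length := by
  suffices h : (splitsTail l).length + 1 = 2 ^ l.length by simpa [splits] using h
  induction l with
  | nil => rfl
  | cons i l ih =>
    simp only [splitsTail, List.length_append, List.length_map, List.length_cons, pow_succ]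
    omega

lemma pd_list_sum {α : Type*} (L : List α) {f : α → E3 → ℂ} (hf : ∀ j, Differentiable ℝ (f j))
    (i : Fin 3) : pd i (fun x => (L.map fun j => f j x).sum) =
      fun x => (L.map fun j => pd i (f j) x).sum := by
  induction L with
  | nil => funext x; simp [pd]
  | cons a L ih =>
    have : Differentiable ℝ (fun x => (L.map fun j => f j x).sum) := by
      clear ih
      induction L with
      | nil => simp
      | cons b L ih => simp only [List.map_cons, List.sum_cons]; exact (hf b).add ih
    simp only [List.map_cons, List.sum_cons]
    rw [pd_add (hf a) this, ih]

/-- A bilinear pairing of smooth functions obeying the product rule satisfies the iterated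
Leibniz formula. -/
lemma dl_leibniz_gen (P : (E3 → ℂ) → (E3 → ℂ) → E3 → ℂ) {f g : E3 → ℂ}
    (hd : ∀ l l', Differentiable ℝ (P (dl l f) (dl l' g)))
    (hP : ∀ l l' i, pd i (P (dl l f) (dl l' g)) = fun x => P (dl l f) (dl (i :: l') g) x +
      P (dl (i :: l) f) (dl l' g) x) (l : List (Fin 3)) :
    dl l (P f g) = fun x => P f (dl l g) x +
      ((splitsTail l).map fun p => P (dl p.1 f) (dl p.2 g) x).sum := by
  induction l with
  | nil => funext x; simp [splitsTail, dl]
  | cons i l ih =>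
    have h1 : dl l (P f g) =
        fun x => ((splits l).map fun p => P (dl p.1 f) (dl p.2 g) x).sum := by
      rw [ih]; funext x; simp [splits, dl]
    rw [dl, h1, pd_list_sum (f := fun p : List (Fin 3) × List (Fin 3) => P (dl p.1 f) (dl p.2 g)) _
      (fun p => hd p.1 p.2)]
    funext x
    simp only [hP, splits, splitsTail, List.map_cons, List.map_append, List.map_map,
      List.sum_cons, List.sum_append, Function.comp_def, List.sum_map_add, dl]
    ring

lemma dl_mul {f g : E3 → ℂ} (hf : ContDiff ℝ ∞ f) (hg : ContDiff ℝ ∞ g) (l : List (Fin 3)) :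
    dl l (fun x => f x * g x) = fun x => f x * dl l g x +
      ((splitsTail l).map fun p => dl p.1 f x * dl p.2 g x).sum := by
  refine dl_leibniz_gen (fun f g x => f x * g x)
    (fun l l' => (contDiff_dl hf l).diffble.mul (contDiff_dl hg l').diffble) ?_ l
  intro l l' i
  rw [pd_mul (contDiff_dl hf l).diffble (contDiff_dl hg l').diffble]
  rfl

lemma dl_mul' {f g : E3 → ℂ} (hf : ContDiff ℝ ∞ f) (hg : ContDiff ℝ ∞ g) (l : List (Fin 3)) :
    dl l (fun x => f x * g x) = fun x =>
      ((splits l).map fun p => dl p.1 f x * dl p.2 g x).sum := by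
  rw [dl_mul hf hg]; funext x; simp [splits, dl]

lemma dl_lapC {g : E3 → ℂ} (hg : ContDiff ℝ ∞ g) (l : List (Fin 3)) :
    dl l (lapC g) = lapC (dl l g) := by
  unfold lapC
  rw [dl_sum _ (fun j => contDiff_pd (contDiff_pd hg j) j)]
  funext x
  refine Finset.sum_congr rfl fun j _ => ?_
  have h1 : dl l (pd j (pd j g)) = dl (l ++ [j, j]) g := by rw [dl_append]; rfl
  have h2 : pd j (pd j (dl l g)) = dl ([j, j] ++ l) g := by rw [dl_append]; rfl
  rw [h1, h2, dl_perm List.perm_append_comm hg]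

lemma dl_pd {g : E3 → ℂ} (hg : ContDiff ℝ ∞ g) (l : List (Fin 3)) (j : Fin 3) :
    dl l (pd j g) = pd j (dl l g) := by
  have h1 : dl l (pd j g) = dl (l ++ [j]) g := by rw [dl_append]; rfl
  have h2 : pd j (dl l g) = dl ([j] ++ l) g := rfl
  rw [h1, h2, dl_perm List.perm_append_comm hg]

/-! ### Schwartz functions -/

lemma IsSchwartzF.contDiff {g : E3 → ℂ} (hg : IsSchwartzF g) : ContDiff ℝ ∞ g :=
  contDiff_infty.2 hg.1

lemma isSchwartzF_iff {g : E3 → ℂ} : IsSchwartzF g ↔ ∃ F : 𝓢(E3, ℂ), ⇑F = g := by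
  constructor
  · intro h
    exact ⟨⟨g, h.contDiff, h.2⟩, rfl⟩
  · rintro ⟨F, rfl⟩
    exact ⟨contDiff_infty.1 (F.smooth ⊤), F.decay'⟩

lemma IsSchwartzF.partial_deriv {g : E3 → ℂ} (hg : IsSchwartzF g) (i : Fin 3) :
    IsSchwartzF (pd i g) := by
  obtain ⟨F, rfl⟩ := isSchwartzF_iff.1 hg
  exact isSchwartzF_iff.2 ⟨∂_{e3 i} F, by ext x; rfl⟩

lemma IsSchwartzF.iterate_pd {g : E3 → ℂ} (hg : IsSchwartzF g) (l : List (Fin 3)) :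
    IsSchwartzF (dl l g) := by
  induction l with
  | nil => exact hg
  | cons i l ih => exact ih.partial_deriv i

lemma IsSchwartzF.sub {f g : E3 → ℂ} (hf : IsSchwartzF f) (hg : IsSchwartzF g) :
    IsSchwartzF (fun x => f x - g x) := by
  obtain ⟨F, rfl⟩ := isSchwartzF_iff.1 hf
  obtain ⟨G, rfl⟩ := isSchwartzF_iff.1 hg
  exact isSchwartzF_iff.2 ⟨F - G, by ext x; rfl⟩

lemma IsSchwartzF.memLp {f : E3 → ℂ} (hf : IsSchwartzF f) (p : ENNReal) : MemLp f p volume := by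
  obtain ⟨F, rfl⟩ := isSchwartzF_iff.1 hf
  exact F.memLp p volume

lemma IsSchwartzF.continuous {f : E3 → ℂ} (hf : IsSchwartzF f) : Continuous f :=
  hf.contDiff.continuous

lemma IsSchwartzF.bounded {f : E3 → ℂ} (hf : IsSchwartzF f) : ∃ C, ∀ x, ‖f x‖ ≤ C := by
  obtain ⟨C, hC⟩ := hf.2 0 0
  exact ⟨C, fun x => by simpa using hC x⟩

/-! ### Functions with a bounded `L²` norm -/

/-- `f` lies in `L²(ℝ³)` with norm at most `c`. -/
def L2le (f : E3 → ℂ) (c : ℝ) : Prop :=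
  AEStronglyMeasurable f volume ∧ 0 ≤ c ∧ eLpNorm f 2 volume ≤ ENNReal.ofReal c

lemma L2le.memLp {f : E3 → ℂ} {c : ℝ} (h : L2le f c) : MemLp f 2 volume :=
  ⟨h.1, h.2.2.trans_lt ENNReal.ofReal_lt_top⟩

lemma L2le.mono {f : E3 → ℂ} {c d : ℝ} (h : L2le f c) (hcd : c ≤ d) : L2le f d :=
  ⟨h.1, h.2.1.trans hcd, h.2.2.trans (ENNReal.ofReal_le_ofReal hcd)⟩

lemma L2le.zero : L2le (fun _ => 0) 0 := by
  refine ⟨aestronglyMeasurable_const, le_rfl, ?_⟩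
  simp

lemma L2le.add {f g : E3 → ℂ} {c d : ℝ} (hf : L2le f c) (hg : L2le g d) :
    L2le (fun x => f x + g x) (c + d) := by
  refine ⟨hf.1.add hg.1, add_nonneg hf.2.1 hg.2.1, ?_⟩
  rw [ENNReal.ofReal_add hf.2.1 hg.2.1]
  exact (eLpNorm_add_le hf.1 hg.1 (by norm_num)).trans (add_le_add hf.2.2 hg.2.2)

lemma L2le.sub {f g : E3 → ℂ} {c d : ℝ} (hf : L2le f c) (hg : L2le g d) :
    L2le (fun x => f x - g x) (c + d) := by
  refine ⟨hf.1.sub hg.1, add_nonneg hf.2.1 hg.2.1, ?_⟩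
  rw [ENNReal.ofReal_add hf.2.1 hg.2.1]
  exact (eLpNorm_sub_le hf.1 hg.1 (by norm_num)).trans (add_le_add hf.2.2 hg.2.2)

lemma L2le.bdd_mul {f g : E3 → ℂ} {c Λ : ℝ} (hf : L2le f c)
    (hg : AEStronglyMeasurable g volume) (h : ∀ x, ‖g x‖ ≤ Λ) :
    L2le (fun x => g x * f x) (Λ * c) := by
  have hΛ : 0 ≤ Λ := (norm_nonneg _).trans (h 0)
  refine ⟨hg.mul hf.1, mul_nonneg hΛ hf.2.1, ?_⟩
  refine (eLpNorm_le_mul_eLpNorm_of_ae_le_mul (c := Λ) (g := f)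
    (Filter.Eventually.of_forall fun x => ?_) 2).trans ?_
  · rw [norm_mul]; exact mul_le_mul_of_nonneg_right (h x) (norm_nonneg _)
  · rw [ENNReal.ofReal_mul hΛ]; gcongr; exact hf.2.2

lemma L2le.const_mul {f : E3 → ℂ} {c : ℝ} (hf : L2le f c) (k : ℂ) :
    L2le (fun x => k * f x) (‖k‖ * c) :=
  hf.bdd_mul aestronglyMeasurable_const fun _ => le_rfl

lemma L2le.list_sum {α : Type*} (L : List α) {f : α → E3 → ℂ} {c : ℝ}
    (h : ∀ j ∈ L, L2le (f j) c) :
    L2le (fun x => (L.map fun j => f j x).sum) (L.length * c) := by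
  induction L with
  | nil => simpa using L2le.zero
  | cons a L ih =>
    simp only [List.map_cons, List.sum_cons, List.length_cons]
    refine ((h a (by simp)).add (ih fun j hj => h j (by simp [hj]))).mono ?_
    push_cast; linarith

lemma L2le.sum3 {f : Fin 3 → E3 → ℂ} {c : ℝ} (h : ∀ j, L2le (f j) c) :
    L2le (fun x => ∑ j, f j x) (3 * c) := by
  simp only [Fin.sum_univ_three]
  exact (((h 0).add (h 1)).add (h 2)).mono (by linarith)

lemma integral_norm_sq_eq {f : E3 → ℂ} (hf : MemLp f 2 volume) :
    ∫ x, ‖f x‖ ^ 2 = (eLpNorm f 2 volume).toReal ^ 2 := by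
  have h := eLpNorm_nnreal_pow_eq_lintegral (f := f) (μ := volume) (p := 2) (by norm_num)
  rw [integral_eq_lintegral_of_nonneg_ae (Filter.Eventually.of_forall fun x => by positivity)
    (by exact hf.1.norm.pow 2), ← ENNReal.toReal_pow]
  congr 1
  have h2 : ((2 : NNReal) : ℝ) = ((2 : ℕ) : ℝ) := by norm_num
  rw [h2] at h
  simp only [ENNReal.rpow_natCast] at h
  rw [show ((2 : NNReal) : ENNReal) = 2 from rfl] at h
  rw [h]
  refine lintegral_congr fun x => ?_
  rw [ENNReal.ofReal_pow (norm_nonneg _), ofReal_norm]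

lemma L2le.integrable {f : E3 → ℂ} {c : ℝ} (h : L2le f c) :
    Integrable (fun x => ‖f x‖ ^ 2) := h.memLp.integrable_norm_pow (by norm_num)

lemma L2le.integral_le {f : E3 → ℂ} {c : ℝ} (h : L2le f c) : ∫ x, ‖f x‖ ^ 2 ≤ c ^ 2 := by
  rw [integral_norm_sq_eq h.memLp]
  gcongr
  exact ENNReal.toReal_le_of_le_ofReal h.2.1 h.2.2

lemma L2le.of_integral {f : E3 → ℂ} {c : ℝ} (hf : MemLp f 2 volume) (hc : 0 ≤ c)
    (h : ∫ x, ‖f x‖ ^ 2 ≤ c ^ 2) : L2le f c := by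
  refine ⟨hf.1, hc, ?_⟩
  rw [integral_norm_sq_eq hf] at h
  rw [ENNReal.le_ofReal_iff_toReal_le hf.2.ne hc]
  exact (sq_le_sq₀ ENNReal.toReal_nonneg hc).1 h

lemma L2le.translate {f : E3 → ℂ} {c : ℝ} (h : L2le f c) (a : E3) :
    L2le (fun x => f (x + a)) c := by
  have hp : MeasurePreserving (fun x : E3 => x + a) volume volume :=
    measurePreserving_add_right volume a
  refine ⟨h.1.comp_measurePreserving hp, h.2.1, ?_⟩
  have := eLpNorm_comp_measurePreserving (p := 2) h.1 hp
  rw [Function.comp_def] at this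
  rw [this]; exact h.2.2

lemma L2le.conj {f : E3 → ℂ} {c : ℝ} (h : L2le f c) :
    L2le (fun x => (starRingEnd ℂ) (f x)) c := by
  refine ⟨Complex.continuous_conj.comp_aestronglyMeasurable h.1, h.2.1, ?_⟩
  rw [eLpNorm_congr_norm_ae (g := f) (Filter.Eventually.of_forall fun x => by simp)]
  exact h.2.2

/-! ### The Sobolev norm -/

lemma sobNorm_nonneg (s : ℕ) (g : E3 → ℂ) : 0 ≤ sobNorm s g := Real.sqrt_nonneg _

lemma sobNorm_sq (s : ℕ) (g : E3 → ℂ) :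
    sobNorm s g ^ 2 = ∑ σ ∈ mIdx s, ∫ x : E3, ‖dl (mword σ) g x‖ ^ 2 := by
  simp only [← mpd_eq_dl]
  exact Real.sq_sqrt (Finset.sum_nonneg fun _ _ => integral_nonneg fun _ => by positivity)

lemma IsSchwartzF.L2le_dl {g : E3 → ℂ} (hg : IsSchwartzF g) {s : ℕ} {l : List (Fin 3)}
    (hl : l.length ≤ s) : L2le (dl l g) (sobNorm s g) := by
  refine .of_integral ((hg.iterate_pd l).memLp 2) (sobNorm_nonneg _ _) ?_
  rw [sobNorm_sq, dl_eq_mpd hg.contDiff, mpd_eq_dl]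
  exact Finset.single_le_sum (f := fun σ => ∫ x : E3, ‖dl (mword σ) g x‖ ^ 2)
    (fun _ _ => integral_nonneg fun _ => by positivity)
    (mem_mIdx.2 ((mdeg_count l).le.trans hl))

lemma sobNorm_mono {s r : ℕ} (h : s ≤ r) (g : E3 → ℂ) : sobNorm s g ≤ sobNorm r g := by
  refine Real.sqrt_le_sqrt (Finset.sum_le_sum_of_subset_of_nonneg ?_ ?_)
  · intro σ hσ; exact mem_mIdx.2 ((mem_mIdx.1 hσ).trans h)
  · intro _ _ _; exact integral_nonneg fun _ => by positivity

/-! ### The Sobolev embedding `H² ⊂ L^∞` in dimension three -/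

lemma e3_inner (i : Fin 3) (ξ : E3) : inner ℝ ξ (e3 i) = ξ i := by
  simp [e3, EuclideanSpace.inner_single_right]

lemma fourier_sub_laplacian (F : 𝓢(E3, ℂ)) (ξ : E3) :
    𝓕 (F - ∑ i, ∂_{e3 i} (∂_{e3 i} F)) ξ = ((1 + 4 * π ^ 2 * ‖ξ‖ ^ 2 : ℝ) : ℂ) * 𝓕 F ξ := by
  have h1 : 𝓕 (F - ∑ i, ∂_{e3 i} (∂_{e3 i} F)) =
      𝓕 F - ∑ i, 𝓕 (∂_{e3 i} (∂_{e3 i} F)) := by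
    simp only [← SchwartzMap.fourierTransformCLM_apply ℂ, map_sub, map_sum]
  have ht : ∀ i, (inner ℝ · (e3 i) : E3 → ℝ).HasTemperateGrowth := fun i => by fun_prop
  have h2 : ∀ i, (𝓕 (∂_{e3 i} (∂_{e3 i} F))) ξ = -(4 * π ^ 2 * (ξ i : ℂ) ^ 2) * 𝓕 F ξ := by
    intro i
    rw [SchwartzMap.fourier_lineDerivOp_eq, SchwartzMap.fourier_lineDerivOp_eq]
    simp only [smul_apply, SchwartzMap.smulLeftCLM_apply_apply (ht i), smul_eq_mul,
      Complex.real_smul]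
    simp only [e3_inner]
    linear_combination (4 * π ^ 2 * (ξ i : ℂ) ^ 2 * 𝓕 F ξ) * Complex.I_sq
  have hn : (‖ξ‖ ^ 2 : ℝ) = ∑ i, (ξ i) ^ 2 := by
    rw [EuclideanSpace.norm_sq_eq]; simp
  rw [h1, hn]
  simp only [sub_apply, sum_apply, h2]
  push_cast
  rw [← Finset.sum_mul, Finset.sum_neg_distrib, ← Finset.mul_sum]
  ring

/-- Sobolev embedding with an absolute constant. -/
lemma exists_sobolev_const : ∃ C : ℝ, 0 < C ∧ ∀ f : E3 → ℂ, IsSchwartzF f → ∀ c : ℝ, 0 < c →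
    (∀ l : List (Fin 3), l.length ≤ 2 → L2le (dl l f) c) → ∀ x, ‖f x‖ ≤ C * c := by
  have hm : Integrable (fun ξ : E3 => ((1 : ℝ) + ‖ξ‖ ^ 2) ^ (-(4 : ℝ) / 2)) :=
    integrable_rpow_neg_one_add_norm_sq (by simp; norm_num)
  set A := ∫ ξ : E3, ((1 : ℝ) + ‖ξ‖ ^ 2) ^ (-(4 : ℝ) / 2) with hA
  have hA0 : 0 ≤ A := integral_nonneg fun ξ => by positivity
  refine ⟨(A + 16) / 2, by linarith, ?_⟩
  intro f hf c hc hL x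
  obtain ⟨F, rfl⟩ := isSchwartzF_iff.1 hf
  set G : 𝓢(E3, ℂ) := F - ∑ i, ∂_{e3 i} (∂_{e3 i} F) with hG
  have hGL : L2le G (4 * c) := by
    have h1 : (G : E3 → ℂ) = fun x => dl [] F x - ∑ i, dl [i, i] F x := by
      funext x
      simp only [hG, sub_apply, sum_apply]
      rfl
    rw [h1]
    exact ((hL [] (by simp)).sub (L2le.sum3 fun i => hL [i, i] (by simp))).mono (by linarith)
  have hGi := hGL.integral_le
  rw [← SchwartzMap.integral_norm_sq_fourier G] at hGi
  have hGint : Integrable (fun ξ => ‖𝓕 G ξ‖ ^ 2) :=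
    ((𝓕 G).memLp 2 volume).integrable_norm_pow (by norm_num)
  have hpt : ∀ ξ, ‖𝓕 F ξ‖ ≤
      (1 / 2) * (c * ((1 : ℝ) + ‖ξ‖ ^ 2) ^ (-(4 : ℝ) / 2) + c⁻¹ * ‖𝓕 G ξ‖ ^ 2) := by
    intro ξ
    have h1 : ‖𝓕 G ξ‖ = (1 + 4 * π ^ 2 * ‖ξ‖ ^ 2) * ‖𝓕 F ξ‖ := by
      rw [hG, fourier_sub_laplacian, norm_mul, Complex.norm_real, Real.norm_of_nonneg]
      positivity
    have h2 : ((1 : ℝ) + ‖ξ‖ ^ 2) ^ (-(4 : ℝ) / 2) = ((1 + ‖ξ‖ ^ 2) ^ 2)⁻¹ := by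
      rw [show (-(4 : ℝ) / 2) = -((2 : ℕ) : ℝ) by norm_num, Real.rpow_neg (by positivity),
        Real.rpow_natCast]
    have h3 : (1 + ‖ξ‖ ^ 2) * ‖𝓕 F ξ‖ ≤ ‖𝓕 G ξ‖ := by
      rw [h1]
      have : (1 : ℝ) ≤ 4 * π ^ 2 := by nlinarith [Real.pi_gt_three]
      gcongr
      nlinarith [sq_nonneg ‖ξ‖]
    rw [h2]
    set m := 1 + ‖ξ‖ ^ 2
    have hm0 : 0 < m := by positivity
    have h4 : ‖𝓕 F ξ‖ ≤ m⁻¹ * ‖𝓕 G ξ‖ := by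
      rw [inv_mul_eq_div, le_div_iff₀ hm0]; linarith
    refine h4.trans ?_
    have h5 := sq_nonneg (c * m⁻¹ - ‖𝓕 G ξ‖)
    have h6 : c⁻¹ * (c * m⁻¹ - ‖𝓕 G ξ‖) ^ 2 =
        c * (m ^ 2)⁻¹ - 2 * (m⁻¹ * ‖𝓕 G ξ‖) + c⁻¹ * ‖𝓕 G ξ‖ ^ 2 := by
      field_simp
      ring
    have h7 : 0 ≤ c⁻¹ * (c * m⁻¹ - ‖𝓕 G ξ‖) ^ 2 := by positivity
    linarith
  have hx : ‖F x‖ ≤ ∫ ξ, ‖𝓕 F ξ‖ := by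
    have h1 : F x = 𝓕 (𝓕 F) (-x) := by
      have := SchwartzMap.fourierInv_apply_eq (𝓕 F)
      rw [FourierPair.fourierInv_fourier_eq] at this
      conv_lhs => rw [this]
      simp
    rw [h1]
    refine (SchwartzMap.norm_fourier_apply_le_toLp_one _ _).trans ?_
    rw [SchwartzMap.norm_toLp_one]
  refine hx.trans ((integral_mono (𝓕 F).integrable.norm
    (((hm.const_mul c).add (hGint.const_mul c⁻¹)).const_mul (1 / 2)) hpt).trans ?_)
  have hI : ∫ ξ : E3, (1 / 2) * (c * ((1 : ℝ) + ‖ξ‖ ^ 2) ^ (-(4 : ℝ) / 2) + c⁻¹ * ‖𝓕 G ξ‖ ^ 2) =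
      (1 / 2) * (c * A + c⁻¹ * ∫ ξ, ‖𝓕 G ξ‖ ^ 2) := by
    rw [integral_const_mul, integral_add (hm.const_mul c) (hGint.const_mul c⁻¹),
      integral_const_mul, integral_const_mul]
  refine (le_of_eq hI).trans ?_
  have : c⁻¹ * ∫ ξ, ‖𝓕 G ξ‖ ^ 2 ≤ c⁻¹ * (4 * c) ^ 2 := by gcongr
  have h8 : c⁻¹ * (4 * c) ^ 2 = 16 * c := by field_simp; norm_num
  nlinarith

/-! ### Convolution with an integrable kernel -/

lemma IsSchwartzF.mul {f g : E3 → ℂ} (hf : IsSchwartzF f) (hg : IsSchwartzF g) :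
    IsSchwartzF (fun x => f x * g x) := by
  obtain ⟨F, rfl⟩ := isSchwartzF_iff.1 hf
  obtain ⟨G, rfl⟩ := isSchwartzF_iff.1 hg
  exact isSchwartzF_iff.2 ⟨SchwartzMap.smulLeftCLM ℂ F G, by
    ext x; rw [SchwartzMap.smulLeftCLM_apply_apply F.hasTemperateGrowth]; rfl⟩

lemma IsSchwartzF.conj {f : E3 → ℂ} (hf : IsSchwartzF f) :
    IsSchwartzF (fun x => (starRingEnd ℂ) (f x)) := by
  obtain ⟨F, rfl⟩ := isSchwartzF_iff.1 hf
  exact isSchwartzF_iff.2 ⟨SchwartzMap.postcompCLM Complex.conjCLE.toContinuousLinearMap F, by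
    ext x; rw [SchwartzMap.postcompCLM_apply]; rfl⟩

lemma IsSchwartzF.dir_deriv {g : E3 → ℂ} (hg : IsSchwartzF g) (v : E3) :
    IsSchwartzF (fun x => fderiv ℝ g x v) := by
  obtain ⟨F, rfl⟩ := isSchwartzF_iff.1 hg
  exact isSchwartzF_iff.2 ⟨∂_{v} F, by ext x; rfl⟩

lemma IsSchwartzF.bounded_fderiv {g : E3 → ℂ} (hg : IsSchwartzF g) :
    ∃ C, ∀ x, ‖fderiv ℝ g x‖ ≤ C := by
  obtain ⟨C, hC⟩ := hg.2 0 1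
  exact ⟨C, fun x => by simpa [norm_iteratedFDeriv_one] using hC x⟩

/-- The convolution `∫ K(y) g(x - y) dy` of a real kernel with a complex function. -/
def convC (K : E3 → ℝ) (g : E3 → ℂ) : E3 → ℂ := fun x => ∫ y, (K y : ℂ) * g (x - y)

lemma integrable_convC {K : E3 → ℝ} (hK : Integrable K) {g : E3 → ℂ} (hg : IsSchwartzF g)
    (x : E3) : Integrable (fun y => (K y : ℂ) * g (x - y)) := by
  obtain ⟨C, hC⟩ := hg.bounded
  refine hK.ofReal.mul_bdd (c := C) ?_ (Filter.Eventually.of_forall fun y => hC _)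
  exact (hg.continuous.comp (continuous_const.sub continuous_id)).aestronglyMeasurable

lemma hasFDerivAt_convC {K : E3 → ℝ} (hK : Integrable K) {g : E3 → ℂ} (hg : IsSchwartzF g)
    (x : E3) :
    Integrable (fun y => (K y : ℂ) • fderiv ℝ g (x - y)) ∧
    HasFDerivAt (convC K g) (∫ y, (K y : ℂ) • fderiv ℝ g (x - y)) x := by
  obtain ⟨C, hC⟩ := hg.bounded_fderiv
  have hcont : Continuous (fderiv ℝ g) := hg.contDiff.continuous_fderiv (by simp)
  have hm : AEStronglyMeasurable (fun y => (K y : ℂ) • fderiv ℝ g (x - y)) volume := by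
    have h1 : AEStronglyMeasurable (fun y => fderiv ℝ g (x - y)) volume :=
      (hcont.comp (continuous_const.sub continuous_id)).aestronglyMeasurable
    have h2 : AEStronglyMeasurable (fun y => (K y : ℂ)) volume :=
      Complex.continuous_ofReal.comp_aestronglyMeasurable hK.1
    exact h2.smul h1
  have hb : ∀ y z, ‖(K y : ℂ) • fderiv ℝ g (z - y)‖ ≤ |K y| * C := fun y z => by
    rw [norm_smul, Complex.norm_real, Real.norm_eq_abs]
    exact mul_le_mul_of_nonneg_left (hC _) (abs_nonneg _)
  have hbi : Integrable (fun y => |K y| * C) := hK.abs.mul_const C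
  refine ⟨hbi.mono' hm (Filter.Eventually.of_forall fun y => hb y x), ?_⟩
  refine hasFDerivAt_integral_of_dominated_of_fderiv_le (s := univ) (bound := fun y => |K y| * C)
    (F' := fun z y => (K y : ℂ) • fderiv ℝ g (z - y))
    Filter.univ_mem (Filter.Eventually.of_forall fun z => (integrable_convC hK hg z).1)
    (integrable_convC hK hg x) hm (Filter.Eventually.of_forall fun y z _ => hb y z) hbi
    (Filter.Eventually.of_forall fun y z _ => ?_)
  have h1 : HasFDerivAt (fun z => g (z - y)) (fderiv ℝ g (z - y)) z :=
    ((hg.contDiff.diffble (z - y)).hasFDerivAt).comp z ((hasFDerivAt_id z).sub_const y)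
  exact h1.const_mul (K y : ℂ)

lemma fderiv_convC_apply {K : E3 → ℝ} (hK : Integrable K) {g : E3 → ℂ} (hg : IsSchwartzF g)
    (v x : E3) : fderiv ℝ (convC K g) x v = convC K (fun z => fderiv ℝ g z v) x := by
  obtain ⟨h1, h2⟩ := hasFDerivAt_convC hK hg x
  rw [h2.fderiv, ContinuousLinearMap.integral_apply h1]
  rfl

lemma contDiff_convC {K : E3 → ℝ} (hK : Integrable K) {g : E3 → ℂ} (hg : IsSchwartzF g) :
    ContDiff ℝ ∞ (convC K g) := by
  refine contDiff_infty.2 fun n => ?_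
  induction n generalizing g with
  | zero =>
    have : Differentiable ℝ (convC K g) := fun x => (hasFDerivAt_convC hK hg x).2.differentiableAt
    exact contDiff_zero.2 this.continuous
  | succ n ih =>
    push_cast
    rw [contDiff_succ_iff_fderiv_apply]
    refine ⟨fun x => (hasFDerivAt_convC hK hg x).2.differentiableAt, by simp, fun v => ?_⟩
    simp only [fderiv_convC_apply hK hg]
    exact ih (hg.dir_deriv v)

lemma dl_convC {K : E3 → ℝ} (hK : Integrable K) {g : E3 → ℂ} (hg : IsSchwartzF g)
    (l : List (Fin 3)) : dl l (convC K g) = convC K (dl l g) := by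
  induction l with
  | nil => rfl
  | cons i l ih =>
    simp only [dl]; rw [ih]
    funext x
    exact fderiv_convC_apply hK (hg.iterate_pd l) _ x

lemma conv3_eq_convC (K g : E3 → ℝ) (x : E3) :
    (conv3 K g x : ℂ) = convC K (fun y => (g y : ℂ)) x := by
  have h : conv3 K g x = ∫ y, K y * g (x - y) := by
    have := integral_sub_left_eq_self (fun y => K (x - y) * g y) volume x
    simp only [sub_sub_cancel] at this
    exact this.symm
  rw [h, convC, ← integral_complex_ofReal]
  simp

lemma L2le_iff_lintegral {f : E3 → ℂ} {c : ℝ} : L2le f c ↔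
    AEStronglyMeasurable f volume ∧ 0 ≤ c ∧ ∫⁻ x, ‖f x‖ₑ ^ 2 ≤ ENNReal.ofReal c ^ 2 := by
  have h := eLpNorm_nnreal_pow_eq_lintegral (f := f) (μ := volume) (p := 2) (by norm_num)
  have h2 : ((2 : NNReal) : ℝ) = ((2 : ℕ) : ℝ) := by norm_num
  rw [h2] at h
  simp only [ENNReal.rpow_natCast] at h
  rw [show ((2 : NNReal) : ENNReal) = 2 from rfl] at h
  rw [← h, L2le, ENNReal.pow_le_pow_left_iff two_ne_zero]

/-- A form of Young's inequality: translates are handled uniformly under the integral. -/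
lemma L2le_convC_mul {K : E3 → ℝ} (hK : Integrable K) {g h : E3 → ℂ}
    (hg : Continuous g) (hh : Continuous h) (hKg : Continuous (convC K g)) {Q : ℝ}
    (hQ : ∀ y, L2le (fun x => g (x - y) * h x) Q) :
    L2le (fun x => convC K g x * h x) ((∫ x, |K x|) * Q) := by
  have hA0 : 0 ≤ ∫ x, |K x| := integral_nonneg fun _ => abs_nonneg _
  refine L2le_iff_lintegral.2 ⟨(hKg.mul hh).aestronglyMeasurable, mul_nonneg hA0 (hQ 0).2.1, ?_⟩
  set A : ENNReal := ∫⁻ y, ‖K y‖ₑ with hA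
  have hAe : ENNReal.ofReal (∫ x, |K x|) = A := by
    rw [hA, ← ofReal_integral_norm_eq_lintegral_enorm hK]; rfl
  have hk : AEMeasurable (fun y => ‖K y‖ₑ) volume := hK.1.enorm
  have hH : Continuous fun p : E3 × E3 => g (p.1 - p.2) * h p.1 :=
    (hg.comp (continuous_fst.sub continuous_snd)).mul (hh.comp continuous_fst)
  have hpt : ∀ x, ‖convC K g x * h x‖ₑ ^ 2 ≤ A * ∫⁻ y, ‖K y‖ₑ * ‖g (x - y) * h x‖ₑ ^ 2 := by
    intro x
    have hHx : AEMeasurable (fun y => ‖g (x - y) * h x‖ₑ) volume :=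
      (hH.comp (Continuous.prodMk_right x)).enorm.aemeasurable
    have h1 : ‖convC K g x * h x‖ₑ ≤ ∫⁻ y, ‖K y‖ₑ * ‖g (x - y) * h x‖ₑ := by
      rw [convC, ← integral_mul_const]
      refine (enorm_integral_le_lintegral_enorm _).trans (lintegral_mono fun y => ?_)
      rw [mul_assoc, enorm_mul]
      gcongr
      rw [← ofReal_norm, ← ofReal_norm, Complex.norm_real]
    have h2 : ∫⁻ y, ‖K y‖ₑ * ‖g (x - y) * h x‖ₑ ≤
        A ^ (1 / 2 : ℝ) * (∫⁻ y, ‖K y‖ₑ * ‖g (x - y) * h x‖ₑ ^ 2) ^ (1 / 2 : ℝ) := by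
      have := ENNReal.lintegral_mul_le_Lp_mul_Lq volume (p := 2) (q := 2)
        Real.HolderConjugate.two_two
        (f := fun y => ‖K y‖ₑ ^ (1 / 2 : ℝ))
        (g := fun y => ‖K y‖ₑ ^ (1 / 2 : ℝ) * ‖g (x - y) * h x‖ₑ)
        (hk.pow_const _) ((hk.pow_const _).mul hHx)
      refine le_trans (le_of_eq (lintegral_congr fun y => ?_)) (this.trans (le_of_eq ?_))
      · simp only [Pi.mul_apply]
        rw [← mul_assoc, ← ENNReal.rpow_add_of_nonneg _ _ (by norm_num) (by norm_num)]
        norm_num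
      · congr 2
        · refine lintegral_congr fun y => ?_
          rw [← ENNReal.rpow_mul]; norm_num
        · refine lintegral_congr fun y => ?_
          rw [ENNReal.mul_rpow_of_nonneg _ _ (by norm_num), ← ENNReal.rpow_mul]
          norm_num
    calc ‖convC K g x * h x‖ₑ ^ 2
        ≤ (A ^ (1 / 2 : ℝ) * (∫⁻ y, ‖K y‖ₑ * ‖g (x - y) * h x‖ₑ ^ 2) ^ (1 / 2 : ℝ)) ^ 2 := by
          gcongr; exact h1.trans h2
      _ = A * ∫⁻ y, ‖K y‖ₑ * ‖g (x - y) * h x‖ₑ ^ 2 := by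
          rw [mul_pow, ← ENNReal.rpow_natCast, ← ENNReal.rpow_natCast, ← ENNReal.rpow_mul,
            ← ENNReal.rpow_mul]
          norm_num
  have hAtop : A ≠ ⊤ := by rw [← hAe]; exact ENNReal.ofReal_ne_top
  calc ∫⁻ x, ‖convC K g x * h x‖ₑ ^ 2
      ≤ ∫⁻ x, A * ∫⁻ y, ‖K y‖ₑ * ‖g (x - y) * h x‖ₑ ^ 2 := lintegral_mono hpt
    _ = A * ∫⁻ x, ∫⁻ y, ‖K y‖ₑ * ‖g (x - y) * h x‖ₑ ^ 2 := lintegral_const_mul' _ _ hAtop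
    _ = A * ∫⁻ y, ∫⁻ x, ‖K y‖ₑ * ‖g (x - y) * h x‖ₑ ^ 2 := by
        rw [lintegral_lintegral_swap]
        exact hk.comp_snd.mul (hH.enorm.aemeasurable.pow_const 2)
    _ ≤ A * ∫⁻ y, ‖K y‖ₑ * ENNReal.ofReal Q ^ 2 := by
        gcongr with y
        rw [lintegral_const_mul' _ _ enorm_ne_top]
        gcongr
        exact (L2le_iff_lintegral.1 (hQ y)).2.2
    _ = ENNReal.ofReal ((∫ x, |K x|) * Q) ^ 2 := by
        rw [lintegral_mul_const'' _ hk, ENNReal.ofReal_mul hA0, hAe, ← hA]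
        ring

/-! ### The trilinear estimate -/

lemma IsSchwartzF.integral_mul_pd {f g : E3 → ℂ} (hf : IsSchwartzF f) (hg : IsSchwartzF g)
    (i : Fin 3) : ∫ x, f x * pd i g x = -∫ x, pd i f x * g x := by
  obtain ⟨F, rfl⟩ := isSchwartzF_iff.1 hf
  obtain ⟨G, rfl⟩ := isSchwartzF_iff.1 hg
  exact SchwartzMap.integral_mul_lineDerivOp_right_eq_neg_left F G (e3 i)

lemma IsSchwartzF.integrable_norm {f : E3 → ℂ} (hf : IsSchwartzF f) :
    Integrable (fun x => ‖f x‖) :=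
  (memLp_one_iff_integrable.1 (hf.memLp 1)).norm

lemma IsSchwartzF.integrable_norm_four {f : E3 → ℂ} (hf : IsSchwartzF f) :
    Integrable (fun x => ‖f x‖ ^ 4) := by
  refine ((hf.mul hf).mul (hf.mul hf)).integrable_norm.congr
    (Filter.Eventually.of_forall fun x => ?_)
  simp only [norm_mul]; ring

lemma IsSchwartzF.integral_pd_norm_four_le {f : E3 → ℂ} (hf : IsSchwartzF f) {S D : ℝ}
    (hS : ∀ x, ‖f x‖ ≤ S) (i : Fin 3) (hD : L2le (pd i (pd i f)) D) :
    ∫ x, ‖pd i f x‖ ^ 4 ≤ (3 * S * D) ^ 2 := by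
  have hS0 : 0 ≤ S := (norm_nonneg _).trans (hS 0)
  set p := pd i f with hp
  have hpS : IsSchwartzF p := hf.partial_deriv i
  have hp4 := hpS.integrable_norm_four
  have hc := hpS.conj
  have hcc := hc.mul hc
  have hpd : pd i (fun x => (starRingEnd ℂ) (p x) * (starRingEnd ℂ) (p x) * p x) = fun x =>
      (starRingEnd ℂ) (p x) * (starRingEnd ℂ) (p x) * pd i p x +
      2 * ((starRingEnd ℂ) (p x) * (starRingEnd ℂ) (pd i p x) * p x) := by
    rw [pd_mul hcc.contDiff.diffble hpS.contDiff.diffble,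
      pd_mul hc.contDiff.diffble hc.contDiff.diffble, pd_conj _ hpS.contDiff.diffble]
    funext x; ring
  have hibp := hf.integral_mul_pd (hcc.mul hpS) i
  have h1 : ∫ x, p x * ((starRingEnd ℂ) (p x) * (starRingEnd ℂ) (p x) * p x) =
      ((∫ x, ‖p x‖ ^ 4 : ℝ) : ℂ) := by
    rw [← integral_complex_ofReal]
    congr 1; funext x
    have := Complex.mul_conj' (p x)
    push_cast
    linear_combination (p x * (starRingEnd ℂ) (p x) + (‖p x‖ : ℂ) ^ 2) * this
  rw [← hp, h1] at hibp
  have h2 : ∫ x, ‖p x‖ ^ 4 ≤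
      ∫ x, ((1 / 2) * ‖p x‖ ^ 4 + (9 * S ^ 2 / 2) * ‖pd i p x‖ ^ 2) := by
    have h3 : ∫ x, ‖p x‖ ^ 4 = ‖∫ x, f x * pd i
        (fun x => (starRingEnd ℂ) (p x) * (starRingEnd ℂ) (p x) * p x) x‖ := by
      rw [hibp, norm_neg, Complex.norm_real, Real.norm_of_nonneg]
      exact integral_nonneg fun x => by positivity
    rw [h3]
    refine (norm_integral_le_integral_norm _).trans (integral_mono
      (hf.mul ((hcc.mul hpS).partial_deriv i)).integrable_norm
      ((hp4.const_mul _).add (hD.integrable.const_mul _)) fun x => ?_)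
    simp only [hpd, norm_mul]
    have h4 : ‖(starRingEnd ℂ) (p x) * (starRingEnd ℂ) (p x) * pd i p x +
      2 * ((starRingEnd ℂ) (p x) * (starRingEnd ℂ) (pd i p x) * p x)‖ ≤
        3 * (‖p x‖ ^ 2 * ‖pd i p x‖) := by
      refine (norm_add_le _ _).trans (le_of_eq ?_)
      simp only [norm_mul, RCLike.norm_conj, Complex.norm_ofNat]; ring
    refine (mul_le_mul (hS x) h4 (norm_nonneg _) hS0).trans ?_
    nlinarith [sq_nonneg (‖p x‖ ^ 2 - 3 * S * ‖pd i p x‖)]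
  rw [integral_add (hp4.const_mul _) (hD.integrable.const_mul _), integral_const_mul,
    integral_const_mul] at h2
  have h5 : (9 * S ^ 2 / 2) * ∫ x, ‖pd i p x‖ ^ 2 ≤ (9 * S ^ 2 / 2) * D ^ 2 := by
    gcongr; exact hD.integral_le
  nlinarith

/-- The bounds enjoyed by a derivative of order `n` of a function in a ball of `H^s`. -/
def DerivBound (s : ℕ) (S B c : ℝ) (n : ℕ) (u : E3 → ℂ) : Prop :=
  Continuous u ∧ L2le u B ∧ (n + 2 ≤ s → ∀ x, ‖u x‖ ≤ S) ∧
    (n = 1 → Integrable (fun x => ‖u x‖ ^ 4) ∧ ∫ x, ‖u x‖ ^ 4 ≤ c ^ 2)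

lemma DerivBound.conj {s n : ℕ} {S B c : ℝ} {u : E3 → ℂ} (h : DerivBound s S B c n u) :
    DerivBound s S B c n (fun x => (starRingEnd ℂ) (u x)) := by
  obtain ⟨h1, h2, h3, h4⟩ := h
  exact ⟨Complex.continuous_conj.comp h1, h2.conj, by simpa using h3, by simpa using h4⟩

lemma DerivBound.translate {s n : ℕ} {S B c : ℝ} {u : E3 → ℂ} (h : DerivBound s S B c n u)
    (y : E3) : DerivBound s S B c n (fun x => u (x - y)) := by
  obtain ⟨h1, h2, h3, h4⟩ := h
  refine ⟨h1.comp (continuous_id.sub continuous_const), ?_, fun h x => h3 h _, fun h => ?_⟩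
  · simpa only [sub_eq_add_neg] using h2.translate (-y)
  · exact ⟨(h4 h).1.comp_sub_right y, by
      rw [integral_sub_right_eq_self (fun x => ‖u x‖ ^ 4) y]; exact (h4 h).2⟩

lemma L2le_mul_of_four {u v : E3 → ℂ} {c : ℝ} (hu : Continuous u) (hv : Continuous v) (hc : 0 ≤ c)
    (hu4 : Integrable (fun x => ‖u x‖ ^ 4) ∧ ∫ x, ‖u x‖ ^ 4 ≤ c ^ 2)
    (hv4 : Integrable (fun x => ‖v x‖ ^ 4) ∧ ∫ x, ‖v x‖ ^ 4 ≤ c ^ 2) :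
    L2le (fun x => u x * v x) c := by
  have hm : AEStronglyMeasurable (fun x => u x * v x) volume := (hu.mul hv).aestronglyMeasurable
  have hi : Integrable fun x => (1 / 2) * (‖u x‖ ^ 4 + ‖v x‖ ^ 4) := (hu4.1.add hv4.1).const_mul _
  have hle : ∀ x, ‖u x * v x‖ ^ 2 ≤ (1 / 2) * (‖u x‖ ^ 4 + ‖v x‖ ^ 4) := fun x => by
    rw [norm_mul]; nlinarith [sq_nonneg (‖u x‖ ^ 2 - ‖v x‖ ^ 2)]
  have hi2 : Integrable fun x => ‖u x * v x‖ ^ 2 :=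
    hi.mono' (hm.norm.pow 2) (Filter.Eventually.of_forall fun x => by
      rw [Real.norm_of_nonneg (by positivity)]; exact hle x)
  refine .of_integral ((memLp_two_iff_integrable_sq_norm hm).2 hi2) hc
    ((integral_mono hi2 hi hle).trans ?_)
  rw [integral_const_mul, integral_add hu4.1 hv4.1]
  linarith [hu4.2, hv4.2]

lemma DerivBound.mul {s n₁ n₂ n₃ : ℕ} {S B c : ℝ} {u v w : E3 → ℂ} (hc : 0 ≤ c) (hs : 2 ≤ s)
    (hS : 0 ≤ S) (hn : n₁ + n₂ + n₃ ≤ s) (hu : DerivBound s S B c n₁ u)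
    (hv : DerivBound s S B c n₂ v) (hw : DerivBound s S B c n₃ w) :
    L2le (fun x => u x * v x * w x) (S * (S * B) + S * c) := by
  have hB : 0 ≤ B := hu.2.1.2.1
  have hle1 : S * (S * B) ≤ S * (S * B) + S * c := by nlinarith [mul_nonneg hS hc]
  have hle2 : S * c ≤ S * (S * B) + S * c := by nlinarith [mul_nonneg hS (mul_nonneg hS hB)]
  obtain ⟨u1, u2, u3, u4⟩ := hu
  obtain ⟨v1, v2, v3, v4⟩ := hv
  obtain ⟨w1, w2, w3, w4⟩ := hw
  by_cases h1 : n₁ + 2 ≤ s <;> by_cases h2 : n₂ + 2 ≤ s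
  · refine L2le.mono ?_ hle1
    have := (w2.bdd_mul v1.aestronglyMeasurable (v3 h2)).bdd_mul u1.aestronglyMeasurable (u3 h1)
    simpa only [mul_assoc] using this
  · by_cases h3 : n₃ + 2 ≤ s
    · refine L2le.mono ?_ hle1
      have := (v2.bdd_mul w1.aestronglyMeasurable (w3 h3)).bdd_mul u1.aestronglyMeasurable (u3 h1)
      convert this using 2; ring
    · refine L2le.mono ?_ hle2
      have := (L2le_mul_of_four v1 w1 hc (v4 (by omega)) (w4 (by omega))).bdd_mul
        u1.aestronglyMeasurable (u3 h1)
      simpa only [mul_assoc] using this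
  · by_cases h3 : n₃ + 2 ≤ s
    · refine L2le.mono ?_ hle1
      have := (u2.bdd_mul w1.aestronglyMeasurable (w3 h3)).bdd_mul v1.aestronglyMeasurable (v3 h2)
      convert this using 2; ring
    · refine L2le.mono ?_ hle2
      have := (L2le_mul_of_four u1 w1 hc (u4 (by omega)) (w4 (by omega))).bdd_mul
        v1.aestronglyMeasurable (v3 h2)
      convert this using 2; ring
  · refine L2le.mono ?_ hle2
    have := (L2le_mul_of_four u1 v1 hc (u4 (by omega)) (v4 (by omega))).bdd_mul
      w1.aestronglyMeasurable (w3 (by omega))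
    convert this using 2; ring

lemma IsSchwartzF.derivBound_dl {C : ℝ}
    (hC : ∀ f : E3 → ℂ, IsSchwartzF f → ∀ c : ℝ, 0 < c →
      (∀ l : List (Fin 3), l.length ≤ 2 → L2le (dl l f) c) → ∀ x, ‖f x‖ ≤ C * c)
    {s : ℕ} (hs : 2 ≤ s) {B : ℝ} (hB : 1 ≤ B) {f : E3 → ℂ} (hf : IsSchwartzF f)
    (hfB : sobNorm s f ≤ B) {l : List (Fin 3)} (hl : l.length ≤ s) :
    DerivBound s (C * B) B (3 * (C * B) * B) l.length (dl l f) := by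
  have hsup : ∀ l : List (Fin 3), l.length + 2 ≤ s → ∀ x, ‖dl l f x‖ ≤ C * B := by
    intro l hl
    refine hC _ (hf.iterate_pd l) B (by linarith) fun l' hl' => ?_
    rw [← dl_append]
    exact (hf.L2le_dl (by rw [List.length_append]; omega)).mono hfB
  refine ⟨(hf.iterate_pd l).continuous, (hf.L2le_dl hl).mono hfB, hsup l, fun h1 => ?_⟩
  refine ⟨(hf.iterate_pd l).integrable_norm_four, ?_⟩
  obtain ⟨i, rfl⟩ := List.length_eq_one_iff.1 h1
  exact hf.integral_pd_norm_four_le (hsup [] (by simpa using hs)) i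
    ((hf.L2le_dl (l := [i, i]) (by simpa using hs)).mono hfB)

/-- The Hartree nonlinearity is bounded in `H^s` by the `L¹` norm of the kernel. -/
lemma exists_trilinear_const (s : ℕ) (hs : 2 ≤ s) (B : ℝ) (hB : 1 ≤ B) : ∃ C : ℝ, 0 < C ∧
    ∀ K : E3 → ℝ, Integrable K → ∀ f : E3 → ℂ, IsSchwartzF f → sobNorm s f ≤ B →
    ContDiff ℝ ∞ (fun x => (conv3 K (fun y => ‖f y‖ ^ 2) x : ℂ)) ∧
    ∀ l : List (Fin 3), l.length ≤ s →
      L2le (dl l (fun x => (conv3 K (fun y => ‖f y‖ ^ 2) x : ℂ) * f x)) (C * ∫ x, |K x|) := by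
  obtain ⟨C, hC0, hC⟩ := exists_sobolev_const
  set S := C * B with hS
  have hS0 : 0 ≤ S := by positivity
  set c := 3 * S * B with hc
  have hc0 : 0 ≤ c := by positivity
  set Q := S * (S * B) + S * c with hQ
  refine ⟨2 ^ s * (2 ^ s * (Q + 1)), by positivity, ?_⟩
  intro K hK f hf hfB
  set g : E3 → ℂ := fun x => f x * (starRingEnd ℂ) (f x) with hg
  have hgS : IsSchwartzF g := hf.mul hf.conj
  have hV : (fun x => (conv3 K (fun y => ‖f y‖ ^ 2) x : ℂ)) = convC K g := by
    funext x
    rw [conv3_eq_convC]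
    congr 1; funext y
    rw [hg]; simp only [Complex.mul_conj']; push_cast; rfl
  have hA0 : 0 ≤ ∫ x, |K x| := integral_nonneg fun _ => abs_nonneg _
  have hVx : ∀ x, (conv3 K (fun y => ‖f y‖ ^ 2) x : ℂ) = convC K g x := fun x => congrFun hV x
  simp only [hVx]
  refine ⟨contDiff_convC hK hgS, fun l hl => ?_⟩
  have hcore : ∀ α β γ : List (Fin 3), α.length + β.length + γ.length ≤ s →
      L2le (fun x => convC K (fun z => dl α f z * (starRingEnd ℂ) (dl β f z)) x * dl γ f x)
        ((∫ x, |K x|) * Q) := by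
    intro α β γ hlen
    have hab := (hf.iterate_pd α).mul (hf.iterate_pd β).conj
    refine L2le_convC_mul hK hab.continuous (hf.iterate_pd γ).continuous
      (contDiff_convC hK hab).continuous fun y => ?_
    have D : ∀ l : List (Fin 3), l.length ≤ s → DerivBound s S B c l.length (dl l f) :=
      fun l hl => hf.derivBound_dl hC hs hB hfB hl
    exact DerivBound.mul hc0 hs hS0 hlen ((D α (by omega)).translate y)
      ((D β (by omega)).conj.translate y) (D γ (by omega))
  have hmid : ∀ α γ : List (Fin 3), α.length + γ.length ≤ s →
      L2le (fun x => dl α (convC K g) x * dl γ f x) (2 ^ s * ((∫ x, |K x|) * Q)) := by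
    intro α γ hlen
    have h1 : (fun x => dl α (convC K g) x * dl γ f x) = fun x => ((splits α).map fun p =>
        convC K (fun z => dl p.1 f z * (starRingEnd ℂ) (dl p.2 f z)) x * dl γ f x).sum := by
      funext x
      rw [dl_convC hK hgS, hg, dl_mul' hf.contDiff hf.conj.contDiff, List.sum_map_mul_right]
      congr 1
      simp only [dl_conj hf.contDiff]
      have : ∀ L : List (List (Fin 3) × List (Fin 3)),
          convC K (fun z => (L.map fun p => dl p.1 f z * (starRingEnd ℂ) (dl p.2 f z)).sum) x =
          (L.map fun p => convC K (fun z => dl p.1 f z * (starRingEnd ℂ) (dl p.2 f z)) x).sum ∧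
          Integrable (fun y => (K y : ℂ) *
            (L.map fun p => dl p.1 f (x - y) * (starRingEnd ℂ) (dl p.2 f (x - y))).sum) := by
        intro L
        induction L with
        | nil => simp [convC]
        | cons p L ih =>
          have hp := integrable_convC hK ((hf.iterate_pd p.1).mul (hf.iterate_pd p.2).conj) x
          constructor
          · simp only [List.map_cons, List.sum_cons]
            rw [← ih.1]
            simp only [convC, mul_add]
            exact integral_add hp ih.2
          · simp only [List.map_cons, List.sum_cons, mul_add]
            exact hp.add ih.2
      exact (this _).1
    rw [h1]
    refine (L2le.list_sum _ fun p hp => hcore p.1 p.2 γ ?_).mono ?_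
    · have := splits_length p hp; omega
    · rw [length_splits]
      push_cast
      have : (2 : ℝ) ^ α.length ≤ 2 ^ s := pow_le_pow_right₀ (by norm_num) (by omega)
      gcongr
  rw [dl_mul' (contDiff_convC hK hgS) hf.contDiff]
  refine (L2le.list_sum _ fun p hp => hmid p.1 p.2 ?_).mono ?_
  · have := splits_length p hp; omega
  · rw [length_splits]
    push_cast
    have h2 : (2 : ℝ) ^ l.length ≤ 2 ^ s := pow_le_pow_right₀ (by norm_num) (by omega)
    have hQ0 : 0 ≤ Q := by positivity
    calc (2 : ℝ) ^ l.length * (2 ^ s * ((∫ x, |K x|) * Q)) ≤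
        2 ^ s * (2 ^ s * ((∫ x, |K x|) * (Q + 1))) := by gcongr; linarith
      _ = _ := by ring

/-! ### Energy estimate -/

lemma exists_cutoff : ∃ C : ℝ, 0 ≤ C ∧ ∀ R : ℝ, 0 < R → ∃ χ : E3 → ℝ, ContDiff ℝ ∞ χ ∧
    HasCompactSupport χ ∧ (∀ x, 0 ≤ χ x ∧ χ x ≤ 1) ∧ (∀ x, ‖x‖ ≤ R → χ x = 1) ∧
    ∀ i x, ‖pd i (fun x => (χ x : ℂ)) x‖ ≤ C / R ∧
      ‖pd i (fun x => (χ x : ℂ)) x‖ * ‖x‖ ≤ 2 * C := by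
  let β : ContDiffBump (0 : E3) := ⟨1, 2, by norm_num, by norm_num⟩
  have hβ : ContDiff ℝ ∞ β := β.contDiff
  obtain ⟨C, hC⟩ := (hβ.continuous_fderiv (by simp)).bounded_above_of_compact_support
    (β.hasCompactSupport.fderiv (𝕜 := ℝ))
  have hC0 : 0 ≤ C := (norm_nonneg _).trans (hC 0)
  refine ⟨C, hC0, fun R hR => ⟨fun x => β (R⁻¹ • x), ?_, ?_, fun x => ⟨β.nonneg, β.le_one⟩, ?_, ?_⟩⟩
  · exact hβ.comp (contDiff_const_smul R⁻¹)
  · exact β.hasCompactSupport.comp_homeomorph (Homeomorph.smulOfNeZero R⁻¹ (inv_ne_zero hR.ne'))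
  · intro x hx
    refine β.one_of_mem_closedBall ?_
    rw [mem_closedBall_zero_iff, norm_smul, norm_inv, Real.norm_of_nonneg hR.le]
    rw [inv_mul_le_iff₀ hR]
    simpa [β] using hx
  · intro i x
    have hd : HasFDerivAt (fun x => ((β (R⁻¹ • x) : ℝ) : ℂ))
        (Complex.ofRealCLM.comp ((fderiv ℝ β (R⁻¹ • x)).comp
          (R⁻¹ • ContinuousLinearMap.id ℝ E3))) x := by
      refine Complex.ofRealCLM.hasFDerivAt.comp x ?_
      exact ((hβ.differentiable (by simp) _).hasFDerivAt).comp x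
        ((hasFDerivAt_id x).const_smul R⁻¹)
    have he : pd i (fun x => ((β (R⁻¹ • x) : ℝ) : ℂ)) x =
        ((R⁻¹ * fderiv ℝ β (R⁻¹ • x) (e3 i) : ℝ) : ℂ) := by
      rw [pd, hd.fderiv]; simp
    have hn : ‖e3 i‖ = 1 := by simp [e3]
    have hb : ‖pd i (fun x => ((β (R⁻¹ • x) : ℝ) : ℂ)) x‖ ≤ C / R := by
      rw [he, Complex.norm_real, norm_mul, norm_inv, Real.norm_of_nonneg hR.le, inv_mul_eq_div]
      gcongr
      refine (ContinuousLinearMap.le_opNorm _ _).trans ?_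
      rw [hn, mul_one]; exact hC _
    refine ⟨hb, ?_⟩
    by_cases hx : ‖x‖ ≤ 2 * R
    · calc _ ≤ C / R * (2 * R) := by gcongr
        _ = 2 * C := by field_simp
    · have h0 : fderiv ℝ β (R⁻¹ • x) = 0 := by
        refine image_eq_zero_of_notMem_tsupport fun hmem => hx ?_
        have h1 := tsupport_fderiv_subset ℝ hmem
        rw [β.tsupport_eq, mem_closedBall_zero_iff, norm_smul, norm_inv, Real.norm_of_nonneg hR.le,
          inv_mul_le_iff₀ hR] at h1
        simp only [β] at h1
        linarith
      rw [he, h0]; simpa using hC0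

lemma integral_cutoff_mul {X : E3 → ℂ} (hX : ContDiff ℝ ∞ X) (hc : HasCompactSupport X)
    {g : E3 → ℂ} (hg : ContDiff ℝ ∞ g) (i : Fin 3) :
    ∫ x, X x * pd i g x = - ∫ x, pd i X x * g x := by
  have hpX : HasCompactSupport (pd i X) := hc.fderiv_apply (𝕜 := ℝ) (e3 i)
  refine integral_mul_fderiv_eq_neg_fderiv_mul_of_integrable ?_ ?_ ?_
    (fun x _ => hX.diffble x) (fun x _ => hg.diffble x)
  · exact ((contDiff_pd hX i).continuous.mul hg.continuous).integrable_of_hasCompactSupport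
      hpX.mul_right
  · exact (hX.continuous.mul (contDiff_pd hg i).continuous).integrable_of_hasCompactSupport
      hc.mul_right
  · exact (hX.continuous.mul hg.continuous).integrable_of_hasCompactSupport hc.mul_right

/-- The local energy identity, tested against a compactly supported cutoff. -/
lemma integral_cutoff_energy {X : E3 → ℂ} (hX : ContDiff ℝ ∞ X) (hc : HasCompactSupport X)
    {b : Fin 3 → E3 → ℂ} (hb : ∀ i, ContDiff ℝ ∞ (b i))
    (hbr : ∀ i x, (starRingEnd ℂ) (b i x) = b i x) {v vt F : E3 → ℂ} (hv : ContDiff ℝ ∞ v)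
    (hF : Continuous F) (ε : ℝ)
    (heq : ∀ x, vt x = -(∑ i, b i x * pd i v x) + Complex.I * ((ε : ℂ) / 2) * lapC v x + F x) :
    ∃ g : Fin 3 → E3 → ℂ, (∀ i, Continuous (g i)) ∧
    (∀ i x, ‖g i x‖ ≤ ‖b i x‖ * ‖v x‖ ^ 2 + |ε| * (‖v x‖ * ‖pd i v x‖)) ∧
    ∫ x, X x * ((starRingEnd ℂ) (v x) * vt x + v x * (starRingEnd ℂ) (vt x)) =
      ∫ x, ((∑ i, pd i X x * g i x) + X x * ((∑ i, pd i (b i) x) * (v x * (starRingEnd ℂ) (v x)) +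
        ((starRingEnd ℂ) (v x) * F x + v x * (starRingEnd ℂ) (F x)))) := by
  have hvc : ContDiff ℝ ∞ (fun x => (starRingEnd ℂ) (v x)) :=
    Complex.conjCLE.toContinuousLinearMap.contDiff.comp hv
  have hpc : ∀ i, ContDiff ℝ ∞ (fun x => (starRingEnd ℂ) (pd i v x)) := fun i =>
    Complex.conjCLE.toContinuousLinearMap.contDiff.comp (contDiff_pd hv i)
  set g : Fin 3 → E3 → ℂ := fun i x => b i x * (v x * (starRingEnd ℂ) (v x)) +
    (-Complex.I * ((ε : ℂ) / 2)) * ((starRingEnd ℂ) (v x) * pd i v x -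
      v x * (starRingEnd ℂ) (pd i v x)) with hg
  have hgs : ∀ i, ContDiff ℝ ∞ (g i) := fun i =>
    ((hb i).mul (hv.mul hvc)).add (contDiff_const.mul
      ((hvc.mul (contDiff_pd hv i)).sub (hv.mul (hpc i))))
  refine ⟨g, fun i => (hgs i).continuous, fun i x => ?_, ?_⟩
  · refine (norm_add_le _ _).trans (add_le_add ?_ ?_)
    · simp only [norm_mul, RCLike.norm_conj]; exact le_of_eq (by ring)
    · rw [norm_mul]
      have h1 := norm_sub_le ((starRingEnd ℂ) (v x) * pd i v x) (v x * (starRingEnd ℂ) (pd i v x))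
      simp only [norm_mul, RCLike.norm_conj] at h1
      simp only [norm_mul, norm_neg, Complex.norm_I, norm_div, Complex.norm_real,
        Complex.norm_ofNat, Real.norm_eq_abs]
      nlinarith [abs_nonneg ε]
  · have hpd : ∀ i, pd i (g i) = fun x => b i x * (pd i v x * (starRingEnd ℂ) (v x) +
        v x * (starRingEnd ℂ) (pd i v x)) + pd i (b i) x * (v x * (starRingEnd ℂ) (v x)) +
        (-Complex.I * ((ε : ℂ) / 2)) * ((starRingEnd ℂ) (v x) * pd i (pd i v) x -
          v x * (starRingEnd ℂ) (pd i (pd i v) x)) := by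
      intro i
      have e1 := (hvc.mul (contDiff_pd hv i))
      have e2 := (hv.mul (hpc i))
      rw [hg]
      simp only
      rw [pd_add ((hb i).mul (hv.mul hvc)).diffble (contDiff_const.mul (e1.sub e2)).diffble,
        pd_mul (hb i).diffble (hv.mul hvc).diffble, pd_mul hv.diffble hvc.diffble,
        pd_const_mul (e1.sub e2).diffble, pd_sub e1.diffble e2.diffble,
        pd_mul hvc.diffble (contDiff_pd hv i).diffble, pd_mul hv.diffble (hpc i).diffble,
        pd_conj _ hv.diffble, pd_conj _ (contDiff_pd hv i).diffble]
      funext x; ring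
    have hpt : ∀ x, (starRingEnd ℂ) (v x) * vt x + v x * (starRingEnd ℂ) (vt x) =
        -(∑ i, pd i (g i) x) + ((∑ i, pd i (b i) x) * (v x * (starRingEnd ℂ) (v x)) +
        ((starRingEnd ℂ) (v x) * F x + v x * (starRingEnd ℂ) (F x))) := by
      intro x
      rw [heq]
      simp only [hpd, lapC, Fin.sum_univ_three, map_add, map_neg, map_mul, map_div₀, Complex.conj_I,
        Complex.conj_ofReal, map_ofNat, hbr]
      ring
    have hpX : ∀ i, HasCompactSupport (pd i X) := fun i => hc.fderiv_apply (𝕜 := ℝ) (e3 i)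
    have hi1 : ∀ i, Integrable fun x => X x * pd i (g i) x := fun i =>
      (hX.continuous.mul (contDiff_pd (hgs i) i).continuous).integrable_of_hasCompactSupport
        hc.mul_right
    have hi2 : ∀ i, Integrable fun x => pd i X x * g i x := fun i =>
      ((contDiff_pd hX i).continuous.mul (hgs i).continuous).integrable_of_hasCompactSupport
        (hpX i).mul_right
    have hcF : Continuous fun x => (∑ i, pd i (b i) x) * (v x * (starRingEnd ℂ) (v x)) +
        ((starRingEnd ℂ) (v x) * F x + v x * (starRingEnd ℂ) (F x)) :=
      ((continuous_finsetSum _ fun i _ => (contDiff_pd (hb i) i).continuous).mul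
        (hv.continuous.mul hvc.continuous)).add ((hvc.continuous.mul hF).add
        (hv.continuous.mul (Complex.continuous_conj.comp hF)))
    have hi3 : Integrable fun x => X x * ((∑ i, pd i (b i) x) * (v x * (starRingEnd ℂ) (v x)) +
        ((starRingEnd ℂ) (v x) * F x + v x * (starRingEnd ℂ) (F x))) :=
      (hX.continuous.mul hcF).integrable_of_hasCompactSupport hc.mul_right
    rw [integral_add (integrable_finsetSum _ fun i _ => hi2 i) hi3,
      integral_finsetSum _ fun i _ => hi2 i]
    have : ∀ x, X x * ((starRingEnd ℂ) (v x) * vt x + v x * (starRingEnd ℂ) (vt x)) =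
        (∑ i, -(X x * pd i (g i) x)) + X x * ((∑ i, pd i (b i) x) * (v x * (starRingEnd ℂ) (v x)) +
        ((starRingEnd ℂ) (v x) * F x + v x * (starRingEnd ℂ) (F x))) := by
      intro x; rw [hpt]
      simp only [Fin.sum_univ_three]; ring
    simp only [this]
    have hi1n : ∀ i, Integrable fun x => -(X x * pd i (g i) x) := fun i => (hi1 i).neg
    rw [integral_add (integrable_finsetSum _ fun i _ => hi1n i) hi3,
      integral_finsetSum _ fun i _ => hi1n i]
    congr 1
    refine Finset.sum_congr rfl fun i _ => ?_
    rw [integral_neg, integral_cutoff_mul hX hc (hgs i), neg_neg]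

lemma norm_cutoff_energy_le {X : E3 → ℂ} (hX : ContDiff ℝ ∞ X) (hc : HasCompactSupport X)
    (hX1 : ∀ x, ‖X x‖ ≤ 1) {a c M Λ N f ε : ℝ} (ha : ∀ i x, ‖pd i X x‖ ≤ a)
    (hc' : ∀ i x, ‖pd i X x‖ * ‖x‖ ≤ c) (hM : 0 ≤ M) (hΛ : 1 ≤ Λ) (hε : 0 ≤ ε)
    {b : Fin 3 → E3 → ℂ} (hb : ∀ i, ContDiff ℝ ∞ (b i))
    (hbr : ∀ i x, (starRingEnd ℂ) (b i x) = b i x)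
    (hbM : ∀ i x, ‖b i x‖ ≤ M + 3 * Λ * ‖x‖) (hbd : ∀ x, ‖∑ i, pd i (b i) x‖ ≤ 3 * Λ)
    {v vt F : E3 → ℂ} (hv : ContDiff ℝ ∞ v) (hF : Continuous F)
    (heq : ∀ x, vt x = -(∑ i, b i x * pd i v x) + Complex.I * ((ε : ℂ) / 2) * lapC v x + F x)
    (hvN : L2le v N) (hpN : ∀ i, L2le (pd i v) N) (hFf : L2le F f) :
    ‖∫ x, X x * ((starRingEnd ℂ) (v x) * vt x + v x * (starRingEnd ℂ) (vt x))‖ ≤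
      (9 * c + 4) * Λ * (∫ x, ‖v x‖ ^ 2) + f ^ 2 + a * (3 * M + 6 * ε) * N ^ 2 := by
  obtain ⟨g, -, hgb, hintg⟩ := integral_cutoff_energy hX hc hb hbr hv hF ε heq
  have ha0 : 0 ≤ a := (norm_nonneg _).trans (ha 0 0)
  have hc0 : 0 ≤ c := (mul_nonneg (norm_nonneg _) (norm_nonneg _)).trans (hc' 0 0)
  rw [hintg]
  set k := 9 * Λ * c + 3 * Λ + 1 with hk
  have i1 := hvN.integrable
  have i2 := hFf.integrable
  have i3 := fun i => (hpN i).integrable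
  have i4 : Integrable fun x => ∑ i, ‖pd i v x‖ ^ 2 := integrable_finsetSum _ fun i _ => i3 i
  have i5 : Integrable fun x => ε * a * ∑ i, ‖pd i v x‖ ^ 2 := i4.const_mul _
  have i6 : ∀ r : ℝ, Integrable fun x => r * ‖v x‖ ^ 2 := fun r => i1.const_mul r
  have i7 : Integrable fun x => a * (3 * M + 3 * ε) * ‖v x‖ ^ 2 + ε * a * ∑ i, ‖pd i v x‖ ^ 2 :=
    (i6 _).add i5
  have i8 : Integrable fun x => ‖F x‖ ^ 2 + (a * (3 * M + 3 * ε) * ‖v x‖ ^ 2 +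
      ε * a * ∑ i, ‖pd i v x‖ ^ 2) := i2.add i7
  have hbi : Integrable fun x => k * ‖v x‖ ^ 2 + (‖F x‖ ^ 2 + (a * (3 * M + 3 * ε) * ‖v x‖ ^ 2 +
      ε * a * ∑ i, ‖pd i v x‖ ^ 2)) :=
    (i6 _).add i8
  refine (norm_integral_le_of_norm_le hbi (Filter.Eventually.of_forall fun x => ?_)).trans ?_
  · have h1 : ∀ i, ‖pd i X x * g i x‖ ≤
        (a * M + 3 * Λ * c) * ‖v x‖ ^ 2 + ε * a * (‖v x‖ ^ 2 + ‖pd i v x‖ ^ 2) := by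
      intro i
      rw [norm_mul]
      have e1 : ‖pd i X x‖ * ‖g i x‖ ≤ ‖pd i X x‖ * ((M + 3 * Λ * ‖x‖) * ‖v x‖ ^ 2 +
          ε * (‖v x‖ * ‖pd i v x‖)) := by
        gcongr
        refine (hgb i x).trans ?_
        rw [abs_of_nonneg hε]
        gcongr; exact hbM i x
      have e2 : ‖v x‖ * ‖pd i v x‖ ≤ ‖v x‖ ^ 2 + ‖pd i v x‖ ^ 2 := by
        nlinarith [sq_nonneg (‖v x‖ - ‖pd i v x‖), sq_nonneg (‖v x‖), sq_nonneg ‖pd i v x‖]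
      have e3 : ‖pd i X x‖ * M ≤ a * M := by gcongr; exact ha i x
      have e4 : ‖pd i X x‖ * (ε * (‖v x‖ * ‖pd i v x‖)) ≤
          a * (ε * (‖v x‖ ^ 2 + ‖pd i v x‖ ^ 2)) := by
        gcongr; exact ha i x
      have e5 : (‖pd i X x‖ * M + 3 * Λ * (‖pd i X x‖ * ‖x‖)) * ‖v x‖ ^ 2 ≤
          (a * M + 3 * Λ * c) * ‖v x‖ ^ 2 := by
        gcongr; exact hc' i x
      nlinarith
    have h2 : ‖X x * ((∑ i, pd i (b i) x) * (v x * (starRingEnd ℂ) (v x)) +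
        ((starRingEnd ℂ) (v x) * F x + v x * (starRingEnd ℂ) (F x)))‖ ≤
        (3 * Λ + 1) * ‖v x‖ ^ 2 + ‖F x‖ ^ 2 := by
      rw [norm_mul]
      have e1 : ‖(∑ i, pd i (b i) x) * (v x * (starRingEnd ℂ) (v x)) +
        ((starRingEnd ℂ) (v x) * F x + v x * (starRingEnd ℂ) (F x))‖ ≤
          3 * Λ * ‖v x‖ ^ 2 + (‖v x‖ * ‖F x‖ + ‖v x‖ * ‖F x‖) := by
        refine (norm_add_le _ _).trans (add_le_add ?_ ((norm_add_le _ _).trans (le_of_eq ?_)))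
        · rw [norm_mul, norm_mul, RCLike.norm_conj, ← sq]
          gcongr; exact hbd x
        · simp only [norm_mul, RCLike.norm_conj]
      calc _ ≤ 1 * (3 * Λ * ‖v x‖ ^ 2 + (‖v x‖ * ‖F x‖ + ‖v x‖ * ‖F x‖)) := by
            gcongr; exact hX1 x
        _ ≤ _ := by nlinarith [sq_nonneg (‖v x‖ - ‖F x‖)]
    refine (norm_add_le _ _).trans ((add_le_add ((norm_sum_le _ _).trans
      (Finset.sum_le_sum fun i _ => h1 i)) h2).trans (le_of_eq ?_))
    simp only [Fin.sum_univ_three, hk]; ring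
  · rw [integral_add (i6 _) i8, integral_add i2 i7, integral_add (i6 _) i5, integral_const_mul,
      integral_const_mul,
      integral_const_mul, integral_finsetSum _ fun i _ => i3 i]
    have j1 := hvN.integral_le
    have j2 := hFf.integral_le
    have j3 : ∑ i, ∫ x, ‖pd i v x‖ ^ 2 ≤ 3 * N ^ 2 := by
      simp only [Fin.sum_univ_three]; linarith [(hpN 0).integral_le, (hpN 1).integral_le,
        (hpN 2).integral_le]
    have j4 : 0 ≤ ∫ x, ‖v x‖ ^ 2 := integral_nonneg fun _ => by positivity
    have k1 : a * (3 * M + 3 * ε) * ∫ x, ‖v x‖ ^ 2 ≤ a * (3 * M + 3 * ε) * N ^ 2 := by gcongr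
    have k2 : ε * a * ∑ i, ∫ x, ‖pd i v x‖ ^ 2 ≤ ε * a * (3 * N ^ 2) := by gcongr
    have k3 : k * ∫ x, ‖v x‖ ^ 2 ≤ (9 * c + 4) * Λ * ∫ x, ‖v x‖ ^ 2 := by
      gcongr; rw [hk]; linarith
    nlinarith

lemma hasDerivAt_cutoff_integral {χ : E3 → ℝ} (hχ : Continuous χ) (hc : HasCompactSupport χ)
    (hχ0 : ∀ x, 0 ≤ χ x) {T : ℝ} {v vt : ℝ → E3 → ℂ}
    (hv : ContinuousOn (fun p : ℝ × E3 => v p.1 p.2) (Icc 0 T ×ˢ univ))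
    (hvt : ContinuousOn (fun p : ℝ × E3 => vt p.1 p.2) (Icc 0 T ×ˢ univ))
    (hder : ∀ t ∈ Ioo 0 T, ∀ x, HasDerivAt (fun τ => v τ x) (vt t x) t) :
    ContinuousOn (fun t => ∫ x, χ x * ‖v t x‖ ^ 2) (Icc 0 T) ∧
    ∀ t ∈ Ioo 0 T, HasDerivAt (fun t => ∫ x, χ x * ‖v t x‖ ^ 2)
      (∫ x, χ x * (2 * inner ℝ (v t x) (vt t x))) t := by
  have hslice : ∀ {u : ℝ → E3 → ℂ}, ContinuousOn (fun p : ℝ × E3 => u p.1 p.2) (Icc 0 T ×ˢ univ) →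
      ∀ t ∈ Icc 0 T, Continuous (u t) := fun hu t ht =>
    continuousOn_univ.1 (hu.comp (Continuous.prodMk_right t).continuousOn
      fun x _ => ⟨ht, mem_univ _⟩)
  constructor
  · refine continuousOn_integral_of_compact_support hc ?_ fun t x _ hx => ?_
    · exact (hχ.comp continuous_snd).continuousOn.mul (hv.norm.pow 2)
    · rw [image_eq_zero_of_notMem_tsupport hx, zero_mul]
  · intro t ht
    have hK : IsCompact (Icc 0 T ×ˢ tsupport χ) := isCompact_Icc.prod hc
    have hcont : ContinuousOn (fun p : ℝ × E3 => 2 * inner ℝ (v p.1 p.2) (vt p.1 p.2))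
        (Icc 0 T ×ˢ univ) := continuousOn_const.mul (ContinuousOn.inner (𝕜 := ℝ) hv hvt)
    obtain ⟨A, hA⟩ := hK.exists_bound_of_continuousOn
      (hcont.mono (prod_mono_right (subset_univ _)))
    have hintg : ∀ {g : E3 → ℝ}, Continuous g → Integrable fun x => χ x * g x := fun hg =>
      (hχ.mul hg).integrable_of_hasCompactSupport hc.mul_right
    refine (hasDerivAt_integral_of_dominated_loc_of_deriv_le (s := Ioo 0 T)
      (F' := fun t x => χ x * (2 * inner ℝ (v t x) (vt t x))) (bound := fun x => χ x * A)
      (Ioo_mem_nhds ht.1 ht.2) ?_ (hintg ((hslice hv t (Ioo_subset_Icc_self ht)).norm.pow 2)) ?_ ?_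
      (hintg continuous_const) ?_).2
    · filter_upwards [Ioo_mem_nhds ht.1 ht.2] with τ hτ
      exact (hintg ((hslice hv τ (Ioo_subset_Icc_self hτ)).norm.pow 2)).1
    · exact (hintg (continuous_const.mul ((hslice hv t (Ioo_subset_Icc_self ht)).inner
        (hslice hvt t (Ioo_subset_Icc_self ht))))).1
    · refine Filter.Eventually.of_forall fun x τ hτ => ?_
      by_cases hx : x ∈ tsupport χ
      · rw [norm_mul, Real.norm_of_nonneg (hχ0 x)]
        exact mul_le_mul_of_nonneg_left (hA (τ, x) ⟨Ioo_subset_Icc_self hτ, hx⟩) (hχ0 x)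
      · simp [image_eq_zero_of_notMem_tsupport hx]
    · refine Filter.Eventually.of_forall fun x τ hτ => ?_
      exact (hder τ hτ x).norm_sq.const_mul (χ x)

/-- `L²` energy estimate for the linear equation `∂_t v + b·∇v = i(ε/2)Δv + F`, with a velocity
field of at most linear growth. -/
lemma exists_energy_const : ∃ C : ℝ, 0 < C ∧ ∀ {T ε Λ M N P r : ℝ} {b : ℝ → Fin 3 → E3 → ℂ}
    {v vt F : ℝ → E3 → ℂ} {f : ℝ → ℝ}, 0 ≤ ε → 1 ≤ Λ → 0 ≤ M → 0 ≤ P → 0 < r →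
    ContinuousOn (fun p : ℝ × E3 => v p.1 p.2) (Icc 0 T ×ˢ univ) →
    ContinuousOn (fun p : ℝ × E3 => vt p.1 p.2) (Icc 0 T ×ˢ univ) →
    (∀ t ∈ Ioo 0 T, ∀ x, HasDerivAt (fun τ => v τ x) (vt t x) t) →
    (∀ t ∈ Icc 0 T, ContDiff ℝ ∞ (v t)) →
    (∀ t ∈ Ioo 0 T, ∀ i, ContDiff ℝ ∞ (b t i)) →
    (∀ t ∈ Ioo 0 T, ∀ i x, (starRingEnd ℂ) (b t i x) = b t i x) →
    (∀ t ∈ Ioo 0 T, ∀ i x, ‖b t i x‖ ≤ M + 3 * Λ * ‖x‖) →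
    (∀ t ∈ Ioo 0 T, ∀ x, ‖∑ i, pd i (b t i) x‖ ≤ 3 * Λ) →
    (∀ t ∈ Ioo 0 T, Continuous (F t)) →
    (∀ t ∈ Ioo 0 T, ∀ x, vt t x =
      -(∑ i, b t i x * pd i (v t) x) + Complex.I * ((ε : ℂ) / 2) * lapC (v t) x + F t x) →
    (∀ t ∈ Icc 0 T, L2le (v t) N) →
    (∀ t ∈ Ioo 0 T, ∀ i, L2le (pd i (v t)) N) →
    (∀ t ∈ Ioo 0 T, L2le (F t) (f t)) →
    (∀ t ∈ Ioo 0 T, C * Λ * (∫ x, ‖v t x‖ ^ 2) + f t ^ 2 ≤ P * exp (r * t)) →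
    ∀ t ∈ Icc 0 T, ∫ x, ‖v t x‖ ^ 2 ≤ (∫ x, ‖v 0 x‖ ^ 2) + P / r * exp (r * t) := by
  obtain ⟨C, hC0, hC⟩ := exists_cutoff
  refine ⟨18 * C + 4, by positivity, ?_⟩
  intro T ε Λ M N P r b v vt F f hε hΛ hM hP hr hv hvt hder hvs hb hbr hbM hbd hF heq
    hvN hpN hFf hfP
    t ht
  have hT : 0 ≤ T := ht.1.trans ht.2
  have h0 : (0 : ℝ) ∈ Icc 0 T := ⟨le_rfl, hT⟩
  set Q := C * (3 * M + 6 * ε) * N ^ 2 with hQ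
  have hQ0 : 0 ≤ Q := by positivity
  have hr0 : r ≠ 0 := hr.ne'
  have key : ∀ R : ℝ, 0 < R → ∃ χ : E3 → ℝ, Continuous χ ∧ (∀ x, 0 ≤ χ x ∧ χ x ≤ 1) ∧
      (∀ x, ‖x‖ ≤ R → χ x = 1) ∧ ∫ x, χ x * ‖v t x‖ ^ 2 ≤
        (∫ x, ‖v 0 x‖ ^ 2) + P / r * exp (r * t) + Q * t / R := by
    intro R hR
    obtain ⟨χ, hχs, hχc, hχ01, hχ1, hχd⟩ := hC R hR
    refine ⟨χ, hχs.continuous, hχ01, hχ1, ?_⟩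
    obtain ⟨hyc, hyd⟩ := hasDerivAt_cutoff_integral hχs.continuous hχc (fun x => (hχ01 x).1)
      hv hvt hder
    set y := fun t => ∫ x, χ x * ‖v t x‖ ^ 2 with hy
    set X : E3 → ℂ := fun x => (χ x : ℂ) with hXdef
    have hXs : ContDiff ℝ ∞ X := Complex.ofRealCLM.contDiff.comp hχs
    have hXc : HasCompactSupport X := hχc.comp_left (g := fun r : ℝ => (r : ℂ)) (by simp)
    have hX1 : ∀ x, ‖X x‖ ≤ 1 := fun x => by
      rw [hXdef]; simp only [Complex.norm_real, Real.norm_of_nonneg (hχ01 x).1]; exact (hχ01 x).2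
    have hD : ∀ τ ∈ Ioo 0 T, (∫ x, χ x * (2 * inner ℝ (v τ x) (vt τ x))) ≤
        P * exp (r * τ) + Q / R := by
      intro τ hτ
      have h1 := norm_cutoff_energy_le hXs hXc hX1 (fun i x => (hχd i x).1) (fun i x => (hχd i x).2)
        hM hΛ hε (hb τ hτ) (hbr τ hτ) (hbM τ hτ) (hbd τ hτ) (hvs τ (Ioo_subset_Icc_self hτ))
        (hF τ hτ) (heq τ hτ) (hvN τ (Ioo_subset_Icc_self hτ)) (hpN τ hτ) (hFf τ hτ)
      have h2 : ∫ x, X x * ((starRingEnd ℂ) (v τ x) * vt τ x + v τ x * (starRingEnd ℂ) (vt τ x)) =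
          ((∫ x, χ x * (2 * inner ℝ (v τ x) (vt τ x)) : ℝ) : ℂ) := by
        rw [← integral_complex_ofReal]
        congr 1; funext x
        have h3 := Complex.add_conj ((starRingEnd ℂ) (v τ x) * vt τ x)
        rw [map_mul, Complex.conj_conj] at h3
        rw [h3, Complex.inner, mul_comm (vt _ x)]
        push_cast; rfl
      rw [h2, Complex.norm_real] at h1
      have h4 := hfP τ hτ
      have h5 : C / R * (3 * M + 6 * ε) * N ^ 2 = Q / R := by rw [hQ]; ring
      rw [h5] at h1
      have h6 := Real.le_norm_self (∫ x, χ x * (2 * inner ℝ (v τ x) (vt τ x)))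
      have h7 : (9 * (2 * C) + 4) * Λ = (18 * C + 4) * Λ := by ring
      rw [h7] at h1
      linarith
    have hzd : ∀ τ ∈ Ioo 0 T, HasDerivAt (fun τ => y τ - P / r * exp (r * τ) - Q / R * τ)
        ((∫ x, χ x * (2 * inner ℝ (v τ x) (vt τ x))) - P * exp (r * τ) - Q / R) τ := by
      intro τ hτ
      have e1 : HasDerivAt (fun τ => P / r * exp (r * τ)) (P * exp (r * τ)) τ := by
        refine ((((hasDerivAt_id τ).const_mul r).exp).const_mul (P / r)).congr_deriv ?_
        simp only [id]; field_simp
      have e2 : HasDerivAt (fun τ => Q / R * τ) (Q / R) τ := by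
        simpa using (hasDerivAt_id τ).const_mul (Q / R)
      exact ((hyd τ hτ).sub e1).sub e2
    have hanti : AntitoneOn (fun τ => y τ - P / r * exp (r * τ) - Q / R * τ) (Icc 0 T) := by
      refine antitoneOn_of_deriv_nonpos (convex_Icc 0 T) ?_ ?_ ?_
      · refine (hyc.sub ?_).sub ?_
        · exact Continuous.continuousOn (by fun_prop)
        · exact Continuous.continuousOn (by fun_prop)
      · rw [interior_Icc]
        exact fun τ hτ => (hzd τ hτ).differentiableAt.differentiableWithinAt
      · rw [interior_Icc]
        intro τ hτ
        rw [(hzd τ hτ).deriv]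
        linarith [hD τ hτ]
    have h1 := hanti h0 ht ht.1
    simp only [mul_zero, exp_zero, mul_one, sub_zero] at h1
    have h2 : y 0 ≤ ∫ x, ‖v 0 x‖ ^ 2 := by
      refine integral_mono_of_nonneg (Filter.Eventually.of_forall fun x => ?_) (hvN 0 h0).integrable
        (Filter.Eventually.of_forall fun x => ?_)
      · exact mul_nonneg (hχ01 x).1 (by positivity)
      · exact mul_le_of_le_one_left (by positivity) (hχ01 x).2
    have h3 : 0 ≤ P / r := by positivity
    have h4 : Q / R * t = Q * t / R := by ring
    linarith
  choose χ hχc hχ01 hχ1 hχ using fun n : ℕ => key (n + 1) (by positivity)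
  have hintg := (hvN t ht).integrable
  have hlim : Filter.Tendsto (fun n => ∫ x, χ n x * ‖v t x‖ ^ 2) Filter.atTop
      (nhds (∫ x, ‖v t x‖ ^ 2)) := by
    refine tendsto_integral_of_dominated_convergence _
      (fun n => (hχc n).aestronglyMeasurable.mul hintg.1) hintg
      (fun n => Filter.Eventually.of_forall fun x => ?_) (Filter.Eventually.of_forall fun x => ?_)
    · rw [Real.norm_of_nonneg (mul_nonneg (hχ01 n x).1 (by positivity))]
      exact mul_le_of_le_one_left (by positivity) (hχ01 n x).2
    · refine tendsto_const_nhds.congr' ?_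
      filter_upwards [Filter.eventually_ge_atTop ⌈‖x‖⌉₊] with n hn
      rw [hχ1 n x, one_mul]
      have := Nat.ceil_le.1 hn
      linarith
  have hlim2 : Filter.Tendsto (fun n : ℕ => (∫ x, ‖v 0 x‖ ^ 2) + P / r * exp (r * t) +
      Q * t / ((n : ℝ) + 1)) Filter.atTop
      (nhds ((∫ x, ‖v 0 x‖ ^ 2) + P / r * exp (r * t) + 0)) := by
    refine tendsto_const_nhds.add ?_
    have := (tendsto_one_div_add_atTop_nhds_zero_nat (𝕜 := ℝ)).const_mul (Q * t)
    rw [mul_zero] at this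
    refine this.congr fun n => ?_
    ring
  rw [add_zero] at hlim2
  exact le_of_tendsto_of_tendsto' hlim hlim2 hχ

/-- Smoothness of a family of functions on `[0,T] × ℝ³`, up to the boundary. -/
def STSmooth (T : ℝ) (U : ℝ → E3 → ℂ) : Prop :=
  ContDiffOn ℝ ∞ (fun p : ℝ × E3 => U p.1 p.2) (Icc 0 T ×ˢ univ)

/-- The time derivative of a family of functions on `[0,T]`. -/
def tder (T : ℝ) (U : ℝ → E3 → ℂ) (t : ℝ) (x : E3) : ℂ :=
  derivWithin (fun τ => U τ x) (Icc 0 T) t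

lemma uniqueDiffOn_slab {T : ℝ} (hT : 0 < T) :
    UniqueDiffOn ℝ (Icc (0 : ℝ) T ×ˢ (univ : Set E3)) :=
  (uniqueDiffOn_Icc hT).prod uniqueDiffOn_univ

lemma mem_closure_interior_slab {T t : ℝ} (hT : 0 < T) (ht : t ∈ Icc 0 T) (x : E3) :
    (t, x) ∈ closure (interior (Icc (0 : ℝ) T ×ˢ (univ : Set E3))) := by
  rw [interior_prod_eq, closure_prod_eq, interior_Icc, closure_Ioo hT.ne]
  simpa using ht

namespace STSmooth

variable {T : ℝ} {U V : ℝ → E3 → ℂ}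

lemma slice (hU : STSmooth T U) {t : ℝ} (ht : t ∈ Icc 0 T) : ContDiff ℝ ∞ (U t) := by
  rw [← contDiffOn_univ]
  exact ContDiffOn.comp (g := fun p : ℝ × E3 => U p.1 p.2) (f := fun x => (t, x)) hU
    (contDiff_prodMk_right t).contDiffOn (fun x _ => ⟨ht, mem_univ _⟩)

lemma hasFDerivWithinAt (hU : STSmooth T U) {t : ℝ} (ht : t ∈ Icc 0 T) (x : E3) :
    HasFDerivWithinAt (fun p : ℝ × E3 => U p.1 p.2)
      (fderivWithin ℝ (fun p : ℝ × E3 => U p.1 p.2) (Icc 0 T ×ˢ univ) (t, x))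
      (Icc 0 T ×ˢ univ) (t, x) :=
  (hU.differentiableOn (by simp) (t, x) ⟨ht, mem_univ _⟩).hasFDerivWithinAt

lemma hasDerivWithinAt (hU : STSmooth T U) {t : ℝ} (ht : t ∈ Icc 0 T) (x : E3) :
    HasDerivWithinAt (fun τ => U τ x)
      (fderivWithin ℝ (fun p : ℝ × E3 => U p.1 p.2) (Icc 0 T ×ˢ univ) (t, x) (1, 0))
      (Icc 0 T) t := by
  have h1 : HasDerivWithinAt (fun τ : ℝ => (τ, x)) ((1 : ℝ), (0 : E3)) (Icc 0 T) t :=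
    (hasDerivWithinAt_id t _).prodMk (hasDerivWithinAt_const t _ x)
  have h2 : MapsTo (fun τ : ℝ => (τ, x)) (Icc 0 T) (Icc (0 : ℝ) T ×ˢ (univ : Set E3)) :=
    fun τ hτ => ⟨hτ, mem_univ _⟩
  exact (hU.hasFDerivWithinAt ht x).comp_hasDerivWithinAt t h1 h2

lemma tder_eq (hT : 0 < T) (hU : STSmooth T U) {t : ℝ} (ht : t ∈ Icc 0 T) (x : E3) :
    tder T U t x =
      fderivWithin ℝ (fun p : ℝ × E3 => U p.1 p.2) (Icc 0 T ×ˢ univ) (t, x) (1, 0) :=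
  (hU.hasDerivWithinAt ht x).derivWithin (uniqueDiffOn_Icc hT t ht)

lemma hasDerivAt (hT : 0 < T) (hU : STSmooth T U) {t : ℝ} (ht : t ∈ Ioo 0 T) (x : E3) :
    HasDerivAt (fun τ => U τ x) (tder T U t x) t := by
  rw [hU.tder_eq hT (Ioo_subset_Icc_self ht)]
  exact (hU.hasDerivWithinAt (Ioo_subset_Icc_self ht) x).hasDerivAt (Icc_mem_nhds ht.1 ht.2)

lemma pd_eq (hU : STSmooth T U) {t : ℝ} (ht : t ∈ Icc 0 T) (i : Fin 3) (x : E3) :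
    pd i (U t) x =
      fderivWithin ℝ (fun p : ℝ × E3 => U p.1 p.2) (Icc 0 T ×ˢ univ) (t, x) (0, e3 i) := by
  have h1 : HasFDerivWithinAt (fun y : E3 => (t, y)) (ContinuousLinearMap.inr ℝ ℝ E3) univ x :=
    (hasFDerivAt_prodMk_right t x).hasFDerivWithinAt
  have h2 := (hU.hasFDerivWithinAt ht x).comp x h1 (fun y _ => ⟨ht, mem_univ _⟩)
  rw [hasFDerivWithinAt_univ] at h2
  have h3 : fderiv ℝ (U t) x = _ := h2.fderiv
  rw [pd, h3]
  rfl

lemma fderivWithin_apply (hT : 0 < T) (hU : STSmooth T U) (v : ℝ × E3) :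
    ContDiffOn ℝ ∞ (fun p : ℝ × E3 =>
      fderivWithin ℝ (fun p : ℝ × E3 => U p.1 p.2) (Icc 0 T ×ˢ univ) p v) (Icc 0 T ×ˢ univ) :=
  (ContDiffOn.fderivWithin hU (uniqueDiffOn_slab hT) (m := ∞) (by simp)).clm_apply contDiffOn_const

lemma tder (hT : 0 < T) (hU : STSmooth T U) : STSmooth T (tder T U) :=
  (hU.fderivWithin_apply hT (1, 0)).congr fun p hp => hU.tder_eq hT hp.1 p.2

lemma pd (hT : 0 < T) (hU : STSmooth T U) (i : Fin 3) : STSmooth T (fun t => pd i (U t)) :=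
  (hU.fderivWithin_apply hT (0, e3 i)).congr fun p hp => hU.pd_eq hp.1 i p.2

lemma dl (hT : 0 < T) (hU : STSmooth T U) (l : List (Fin 3)) :
    STSmooth T (fun t => dl l (U t)) := by
  induction l with
  | nil => exact hU
  | cons i l ih => exact ih.pd hT i

lemma sub (hU : STSmooth T U) (hV : STSmooth T V) : STSmooth T (fun t x => U t x - V t x) :=
  ContDiffOn.sub hU hV

lemma const_mul (hU : STSmooth T U) (c : ℂ) : STSmooth T (fun t x => c * U t x) :=
  contDiffOn_const.mul hU

lemma translate (hU : STSmooth T U) (h : E3) : STSmooth T (fun t x => U t (x + h)) := by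
  have h1 : ContDiff ℝ ∞ (fun p : ℝ × E3 => (p.1, p.2 + h)) := by fun_prop
  exact ContDiffOn.comp hU h1.contDiffOn (fun p hp => ⟨hp.1, mem_univ _⟩)

lemma continuousOn (hU : STSmooth T U) :
    ContinuousOn (fun p : ℝ × E3 => U p.1 p.2) (Icc 0 T ×ˢ univ) := ContDiffOn.continuousOn hU

lemma tder_sub (hT : 0 < T) (hU : STSmooth T U) (hV : STSmooth T V) {t : ℝ} (ht : t ∈ Icc 0 T)
    (x : E3) : _root_.tder T (fun t x => U t x - V t x) t x =
      _root_.tder T U t x - _root_.tder T V t x := by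
  rw [hU.tder_eq hT ht, hV.tder_eq hT ht]
  exact ((hU.hasDerivWithinAt ht x).sub (hV.hasDerivWithinAt ht x)).derivWithin
    (uniqueDiffOn_Icc hT t ht)

lemma tder_pd (hT : 0 < T) (hU : STSmooth T U) (i : Fin 3) {t : ℝ} (ht : t ∈ Icc 0 T) (x : E3) :
    _root_.tder T (fun t => _root_.pd i (U t)) t x = _root_.pd i (_root_.tder T U t) x := by
  set S := Icc (0 : ℝ) T ×ˢ (univ : Set E3) with hS
  set G := fun p : ℝ × E3 => U p.1 p.2 with hG
  have hmem : (t, x) ∈ S := ⟨ht, mem_univ _⟩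
  have hu := uniqueDiffOn_slab hT
  have hsymm : IsSymmSndFDerivWithinAt ℝ G S (t, x) :=
    (hU (t, x) hmem).isSymmSndFDerivWithinAt (by simp; exact WithTop.coe_le_coe.2 le_top) hu
      (mem_closure_interior_slab hT ht x) hmem
  have hd : DifferentiableWithinAt ℝ (fderivWithin ℝ G S) S (t, x) :=
    (ContDiffOn.fderivWithin hU hu (m := ∞) (by simp)).differentiableOn (by simp) (t, x) hmem
  have hc : ∀ v w : ℝ × E3, fderivWithin ℝ (fun p => fderivWithin ℝ G S p v) S (t, x) w =
      fderivWithin ℝ (fderivWithin ℝ G S) S (t, x) w v := by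
    intro v w
    have h1 := hd.hasFDerivWithinAt.clm_apply (hasFDerivWithinAt_const v (t, x) S)
    rw [h1.fderivWithin (hu _ hmem)]
    simp
  rw [(hU.pd hT i).tder_eq hT ht, (hU.tder hT).pd_eq ht i x]
  have e1 : fderivWithin ℝ (fun p : ℝ × E3 => _root_.pd i (U p.1) p.2) S (t, x) =
      fderivWithin ℝ (fun p => fderivWithin ℝ G S p (0, e3 i)) S (t, x) :=
    fderivWithin_congr (fun p hp => hU.pd_eq hp.1 i p.2) (hU.pd_eq ht i x)
  have e2 : fderivWithin ℝ (fun p : ℝ × E3 => _root_.tder T U p.1 p.2) S (t, x) =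
      fderivWithin ℝ (fun p => fderivWithin ℝ G S p (1, 0)) S (t, x) :=
    fderivWithin_congr (fun p hp => hU.tder_eq hT hp.1 p.2) (hU.tder_eq hT ht x)
  rw [e1, e2, hc, hc]
  exact hsymm _ _

lemma tder_dl (hT : 0 < T) (hU : STSmooth T U) (l : List (Fin 3)) {t : ℝ} (ht : t ∈ Icc 0 T) :
    _root_.tder T (fun t => _root_.dl l (U t)) t = _root_.dl l (_root_.tder T U t) := by
  induction l with
  | nil => rfl
  | cons i l ih =>
    funext x
    have h := (hU.dl hT l).tder_pd hT i ht x
    rw [ih] at h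
    exact h

end STSmooth

lemma pd_ofReal {f : E3 → ℝ} (hf : Differentiable ℝ f) (i : Fin 3) :
    pd i (fun x => (f x : ℂ)) = fun x => (pdR i f x : ℂ) := by
  funext x
  have h := (Complex.ofRealCLM.hasFDerivAt (x := f x)).comp x (hf x).hasFDerivAt
  have h2 : fderiv ℝ (fun x => (f x : ℂ)) x = _ := h.fderiv
  rw [pd, h2]
  rfl

lemma contDiff_pdR {f : E3 → ℝ} (hf : ContDiff ℝ ∞ f) (i : Fin 3) : ContDiff ℝ ∞ (pdR i f) :=
  (hf.fderiv_right (m := ∞) (by simp)).clm_apply contDiff_const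

lemma iterate_pd_ofReal {f : E3 → ℝ} (hf : ContDiff ℝ ∞ f) (i : Fin 3) (n : ℕ) :
    ContDiff ℝ ∞ ((pdR i)^[n] f) ∧
      (pd i)^[n] (fun x => (f x : ℂ)) = fun x => ((pdR i)^[n] f x : ℂ) := by
  induction n with
  | zero => exact ⟨hf, rfl⟩
  | succ n ih =>
    rw [Function.iterate_succ_apply', Function.iterate_succ_apply', ih.2]
    exact ⟨contDiff_pdR ih.1 i, pd_ofReal (ih.1.differentiable (by simp)) i⟩

lemma mpd_ofReal {f : E3 → ℝ} (hf : ContDiff ℝ ∞ f) (σ : Fin 3 → ℕ) :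
    mpd σ (fun x => (f x : ℂ)) = fun x => (mpdR σ f x : ℂ) := by
  obtain ⟨h1, e1⟩ := iterate_pd_ofReal hf 2 (σ 2)
  obtain ⟨h2, e2⟩ := iterate_pd_ofReal h1 1 (σ 1)
  obtain ⟨h3, e3⟩ := iterate_pd_ofReal h2 0 (σ 0)
  rw [mpd, e1, e2, e3]
  rfl

lemma lapC_ofReal {f : E3 → ℝ} (hf : ContDiff ℝ ∞ f) (x : E3) :
    lapC (fun x => (f x : ℂ)) x = (lapR f x : ℂ) := by
  simp only [lapC, lapR]
  push_cast
  refine Finset.sum_congr rfl fun i _ => ?_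
  rw [pd_ofReal (hf.differentiable (by simp)),
    pd_ofReal ((contDiff_pdR hf i).differentiable (by simp))]

/-- The difference quotient of step `h` in the `j`-th coordinate direction. -/
def dq (h : ℝ) (j : Fin 3) (f : E3 → ℂ) (x : E3) : ℂ := (h : ℂ)⁻¹ * (f (x + h • e3 j) - f x)

lemma contDiff_translate {f : E3 → ℂ} (hf : ContDiff ℝ ∞ f) (a : E3) :
    ContDiff ℝ ∞ (fun x => f (x + a)) :=
  hf.comp (contDiff_id.add contDiff_const)

lemma pd_translate (f : E3 → ℂ) (a : E3) (i : Fin 3) :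
    pd i (fun x => f (x + a)) = fun x => pd i f (x + a) := by
  funext x
  simp only [pd, fderiv_comp_add_right]

lemma contDiff_dq {f : E3 → ℂ} (hf : ContDiff ℝ ∞ f) (h : ℝ) (j : Fin 3) :
    ContDiff ℝ ∞ (dq h j f) :=
  contDiff_const.mul ((contDiff_translate hf _).sub hf)

lemma pd_dq {f : E3 → ℂ} (hf : ContDiff ℝ ∞ f) (h : ℝ) (i j : Fin 3) :
    pd i (dq h j f) = dq h j (pd i f) := by
  have h1 := contDiff_translate hf (h • e3 j)
  have h2 := pd_const_mul (h1.sub hf).diffble (h : ℂ)⁻¹ i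
  have h3 := pd_sub h1.diffble hf.diffble i
  rw [pd_translate] at h3
  rw [h3] at h2
  exact h2

lemma lapC_dq {f : E3 → ℂ} (hf : ContDiff ℝ ∞ f) (h : ℝ) (j : Fin 3) :
    lapC (dq h j f) = dq h j (lapC f) := by
  funext x
  simp only [lapC, pd_dq hf, pd_dq (contDiff_pd hf _), dq]
  rw [← Finset.sum_sub_distrib, Finset.mul_sum]

lemma hasDerivAt_line {f : E3 → ℂ} (hf : ContDiff ℝ ∞ f) (h : ℝ) (j : Fin 3) (x : E3) (θ : ℝ) :
    HasDerivAt (fun θ : ℝ => f (x + (θ * h) • e3 j)) ((h : ℂ) * pd j f (x + (θ * h) • e3 j)) θ := by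
  have h1 : HasDerivAt (fun θ : ℝ => x + (θ * h) • e3 j) (h • e3 j) θ := by
    have := (((hasDerivAt_id θ).mul_const h).smul_const (e3 j)).const_add x
    simpa using this
  have h2 := (hf.diffble (x + (θ * h) • e3 j)).hasFDerivAt.comp_hasDerivAt θ h1
  refine h2.congr_deriv ?_
  rw [map_smul, pd, Complex.real_smul]

lemma continuous_line {f : E3 → ℂ} (hf : Continuous f) (h : ℝ) (j : Fin 3) (x : E3) :
    Continuous (fun θ : ℝ => f (x + (θ * h) • e3 j)) :=
  hf.comp (by fun_prop)

lemma dq_eq_integral {f : E3 → ℂ} (hf : ContDiff ℝ ∞ f) {h : ℝ} (hh : h ≠ 0) (j : Fin 3) (x : E3) :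
    dq h j f x = ∫ θ in Ioc (0 : ℝ) 1, pd j f (x + (θ * h) • e3 j) := by
  have hc := continuous_line (contDiff_pd hf j).continuous h j x
  have h1 := intervalIntegral.integral_eq_sub_of_hasDerivAt (a := 0) (b := 1)
    (fun θ _ => hasDerivAt_line hf h j x θ)
    ((continuous_const.mul hc).intervalIntegrable _ _)
  rw [intervalIntegral.integral_const_mul, intervalIntegral.integral_of_le zero_le_one] at h1
  simp only [one_mul, zero_mul, zero_smul, add_zero] at h1
  have hh' : (h : ℂ) ≠ 0 := by exact_mod_cast hh
  rw [dq, ← h1, inv_mul_cancel_left₀ hh']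

lemma norm_dq_le {f : E3 → ℂ} (hf : ContDiff ℝ ∞ f) {h : ℝ} (hh : h ≠ 0) {j : Fin 3} {Λ : ℝ}
    (hb : ∀ x, ‖pd j f x‖ ≤ Λ) (x : E3) : ‖dq h j f x‖ ≤ Λ := by
  rw [dq_eq_integral hf hh]
  have := norm_setIntegral_le_of_norm_le_const (μ := volume) (s := Ioc (0 : ℝ) 1)
    (f := fun θ : ℝ => pd j f (x + (θ * h) • e3 j)) (C := Λ) (by simp) (fun θ _ => hb _)
  simpa using this

lemma L2le.dq {f : E3 → ℂ} (hf : ContDiff ℝ ∞ f) {h : ℝ} (hh : h ≠ 0) {j : Fin 3} {c : ℝ}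
    (hp : L2le (pd j f) c) : L2le (dq h j f) c := by
  rw [L2le_iff_lintegral] at hp ⊢
  refine ⟨(contDiff_dq hf h j).continuous.aestronglyMeasurable, hp.2.1, ?_⟩
  have hpc := (contDiff_pd hf j).continuous
  set μ := volume.restrict (Ioc (0 : ℝ) 1) with hμ
  have : IsProbabilityMeasure μ := ⟨by simp [hμ]⟩
  have key : ∀ x, ‖_root_.dq h j f x‖ₑ ^ 2 ≤ ∫⁻ θ, ‖pd j f (x + (θ * h) • e3 j)‖ₑ ^ 2 ∂μ := by
    intro x
    have hc := continuous_line hpc h j x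
    rw [dq_eq_integral hf hh]
    have h1 := enorm_integral_le_lintegral_enorm (μ := μ) fun θ : ℝ => pd j f (x + (θ * h) • e3 j)
    have h2 := eLpNorm_le_eLpNorm_of_exponent_le (p := 1) (q := (2 : NNReal)) (μ := μ) (by norm_num)
      hc.aestronglyMeasurable
    rw [eLpNorm_one_eq_lintegral_enorm] at h2
    have h3 := eLpNorm_nnreal_pow_eq_lintegral (f := fun θ : ℝ => pd j f (x + (θ * h) • e3 j))
      (μ := μ) (p := 2) (by norm_num)
    have h4 : ((2 : NNReal) : ℝ) = ((2 : ℕ) : ℝ) := by norm_num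
    rw [h4] at h3
    simp only [ENNReal.rpow_natCast] at h3
    rw [← h3]
    gcongr
    exact h1.trans h2
  have hm : Measurable (Function.uncurry fun (x : E3) (θ : ℝ) =>
      ‖pd j f (x + (θ * h) • e3 j)‖ₑ ^ 2) := by
    refine Continuous.measurable ?_
    have : Continuous fun p : E3 × ℝ => pd j f (p.1 + (p.2 * h) • e3 j) := hpc.comp (by fun_prop)
    exact (ENNReal.continuous_pow 2).comp this.enorm
  calc ∫⁻ x, ‖_root_.dq h j f x‖ₑ ^ 2
      ≤ ∫⁻ x, ∫⁻ θ, ‖pd j f (x + (θ * h) • e3 j)‖ₑ ^ 2 ∂μ := lintegral_mono key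
    _ = ∫⁻ θ, (∫⁻ x, ‖pd j f (x + (θ * h) • e3 j)‖ₑ ^ 2) ∂μ :=
      lintegral_lintegral_swap hm.aemeasurable
    _ = ∫⁻ θ, (∫⁻ x, ‖pd j f x‖ₑ ^ 2) ∂μ := by
        congr 1; funext θ
        exact lintegral_add_right_eq_self (fun x => ‖pd j f x‖ₑ ^ 2) _
    _ ≤ ENNReal.ofReal c ^ 2 := by simpa using hp.2.2

lemma tendsto_dq {f : E3 → ℂ} (hf : ContDiff ℝ ∞ f) (j : Fin 3) (x : E3) :
    Filter.Tendsto (fun n : ℕ => dq (1 / ((n : ℝ) + 1)) j f x) Filter.atTop (nhds (pd j f x)) := by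
  have h1 := hasDerivAt_line hf 1 j x 0
  rw [hasDerivAt_iff_tendsto_slope_zero] at h1
  have h2 : Filter.Tendsto (fun n : ℕ => 1 / ((n : ℝ) + 1)) Filter.atTop (nhdsWithin 0 {0}ᶜ) := by
    refine tendsto_nhdsWithin_iff.2 ⟨tendsto_one_div_add_atTop_nhds_zero_nat, ?_⟩
    exact Filter.Eventually.of_forall fun n => by
      have : (0 : ℝ) < 1 / ((n : ℝ) + 1) := by positivity
      exact this.ne'
  have h3 := h1.comp h2
  simp only [mul_one, zero_smul, add_zero, zero_add, Complex.ofReal_one, one_mul] at h3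
  refine h3.congr fun n => ?_
  simp only [Function.comp, dq, Complex.real_smul, Complex.ofReal_inv]

lemma L2le.of_dq {f : E3 → ℂ} (hf : ContDiff ℝ ∞ f) {j : Fin 3} {c : ℝ}
    (H : ∀ h : ℝ, 0 < h → L2le (_root_.dq h j f) c) : L2le (pd j f) c := by
  refine L2le_iff_lintegral.2 ⟨(contDiff_pd hf j).continuous.aestronglyMeasurable,
    (H 1 one_pos).2.1, ?_⟩
  have hpos : ∀ n : ℕ, (0 : ℝ) < 1 / ((n : ℝ) + 1) := fun n => by positivity
  calc ∫⁻ x, ‖pd j f x‖ₑ ^ 2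
      = ∫⁻ x, Filter.liminf (fun n : ℕ => ‖_root_.dq (1 / ((n : ℝ) + 1)) j f x‖ₑ ^ 2)
          Filter.atTop := by
        congr 1; funext x
        exact (((ENNReal.continuous_pow 2).tendsto _).comp (tendsto_dq hf j x).enorm).liminf_eq.symm
    _ ≤ Filter.liminf (fun n : ℕ => ∫⁻ x, ‖_root_.dq (1 / ((n : ℝ) + 1)) j f x‖ₑ ^ 2)
          Filter.atTop := by
        refine lintegral_liminf_le fun n => ?_
        exact ((ENNReal.continuous_pow 2).comp (contDiff_dq hf _ j).continuous.enorm).measurable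
    _ ≤ ENNReal.ofReal c ^ 2 := by
        refine Filter.liminf_le_of_le (by isBoundedDefault) fun b hb => ?_
        obtain ⟨n, hn⟩ := hb.exists
        exact hn.trans (L2le_iff_lintegral.1 (H _ (hpos n))).2.2

/-- The residual `u_t + b·∇u - i(ε/2)Δu`. -/
def forcing (b : Fin 3 → E3 → ℂ) (ε : ℝ) (u ut : E3 → ℂ) (x : E3) : ℂ :=
  ut x + (∑ i, b i x * pd i u x) - Complex.I * ((ε : ℂ) / 2) * lapC u x

lemma contDiff_lapC {g : E3 → ℂ} (hg : ContDiff ℝ ∞ g) : ContDiff ℝ ∞ (lapC g) :=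
  ContDiff.sum fun i _ => contDiff_pd (contDiff_pd hg i) i

section

variable {b : Fin 3 → E3 → ℂ} {ε : ℝ} {u ut w wt F₀ : E3 → ℂ}

lemma contDiff_forcing (hb : ∀ i, ContDiff ℝ ∞ (b i)) (hu : ContDiff ℝ ∞ u)
    (hut : ContDiff ℝ ∞ ut) : ContDiff ℝ ∞ (forcing b ε u ut) :=
  (hut.add (ContDiff.sum fun i _ => (hb i).mul (contDiff_pd hu i))).sub
    (contDiff_const.mul (contDiff_lapC hu))

lemma forcing_dq (hu : ContDiff ℝ ∞ u) (h : ℝ) (j : Fin 3) :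
    forcing b ε (dq h j u) (dq h j ut) = fun x =>
      dq h j (forcing b ε u ut) x - ∑ i, dq h j (b i) x * pd i u (x + h • e3 j) := by
  funext x
  simp only [forcing, lapC_dq hu, pd_dq hu, Fin.sum_univ_three, dq]
  ring

lemma pd_forcing (hb : ∀ i, ContDiff ℝ ∞ (b i)) (hu : ContDiff ℝ ∞ u)
    (hut : ContDiff ℝ ∞ ut) (j : Fin 3) :
    pd j (forcing b ε u ut) = fun x =>
      forcing b ε (pd j u) (pd j ut) x + ∑ i, pd j (b i) x * pd i u x := by
  have hs : ∀ i, ContDiff ℝ ∞ fun x => b i x * pd i u x := fun i => (hb i).mul (contDiff_pd hu i)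
  have hS : ContDiff ℝ ∞ fun x => ∑ i, b i x * pd i u x := ContDiff.sum fun i _ => hs i
  have hL : ContDiff ℝ ∞ fun x => Complex.I * ((ε : ℂ) / 2) * lapC u x :=
    contDiff_const.mul (contDiff_lapC hu)
  have e0 := pd_sub (hut.add hS).diffble hL.diffble j
  have e1 := pd_add hut.diffble hS.diffble j
  have e2 := pd_sum Finset.univ (fun i _ => (hs i).diffble) j
  have e3 := pd_const_mul (contDiff_lapC hu).diffble (Complex.I * ((ε : ℂ) / 2)) j
  have e4 : pd j (lapC u) = lapC (pd j u) := dl_lapC hu [j]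
  funext x
  have e5 : ∀ i, pd j (fun x => b i x * pd i u x) x =
      b i x * pd i (pd j u) x + pd j (b i) x * pd i u x := fun i => by
    rw [pd_mul (hb i).diffble (contDiff_pd hu i).diffble, pd_comm hu j i]
  have e6 : pd j (forcing b ε u ut) x = pd j ut x + (∑ i, pd j (fun x => b i x * pd i u x) x) -
      Complex.I * ((ε : ℂ) / 2) * lapC (pd j u) x := by
    have := congrFun e0 x
    rw [e1, e3, e2, e4] at this
    exact this
  rw [e6]
  simp only [e5, forcing, Finset.sum_add_distrib]
  ring

lemma forcing_dl (hb : ∀ i, ContDiff ℝ ∞ (b i)) (hw : ContDiff ℝ ∞ w) (hF : ContDiff ℝ ∞ F₀)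
    (heq : wt = fun x => -(∑ i, b i x * pd i w x) + Complex.I * ((ε : ℂ) / 2) * lapC w x + F₀ x)
    (l : List (Fin 3)) :
    forcing b ε (dl l w) (dl l wt) = fun x => dl l F₀ x -
      ∑ i, ((splitsTail l).map fun p => dl p.1 (b i) x * dl p.2 (pd i w) x).sum := by
  have hs : ∀ i, ContDiff ℝ ∞ fun x => b i x * pd i w x := fun i => (hb i).mul (contDiff_pd hw i)
  have hS : ContDiff ℝ ∞ fun x => ∑ i, b i x * pd i w x := ContDiff.sum fun i _ => hs i
  have hL : ContDiff ℝ ∞ fun x => Complex.I * ((ε : ℂ) / 2) * lapC w x :=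
    contDiff_const.mul (contDiff_lapC hw)
  have heq' : wt = fun x =>
      (Complex.I * ((ε : ℂ) / 2) * lapC w x + F₀ x) - ∑ i, b i x * pd i w x := by
    rw [heq]; funext x; ring
  have e0 := dl_sub (hL.add hF) hS l
  have e1 := dl_add hL hF l
  have e2 := dl_const_mul (contDiff_lapC hw) (Complex.I * ((ε : ℂ) / 2)) l
  have e3 := dl_sum Finset.univ hs l
  funext x
  have e5 : ∀ i, dl l (fun x => b i x * pd i w x) x = b i x * pd i (dl l w) x +
      ((splitsTail l).map fun p => dl p.1 (b i) x * dl p.2 (pd i w) x).sum := fun i => by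
    rw [dl_mul (hb i) (contDiff_pd hw i), dl_pd hw]
  have e6 : dl l wt x = (Complex.I * ((ε : ℂ) / 2) * lapC (dl l w) x + dl l F₀ x) -
      ∑ i, dl l (fun x => b i x * pd i w x) x := by
    have := congrFun e0 x
    rw [e1, e2, e3, dl_lapC hw] at this
    rw [heq']
    exact this
  simp only [forcing, e6, e5, Finset.sum_add_distrib]
  ring

lemma L2le_forcing_dl {s : ℕ} {Λ κ : ℝ} (hΛ : 0 ≤ Λ) (hb : ∀ i, ContDiff ℝ ∞ (b i))
    (hw : IsSchwartzF w) (hF : ContDiff ℝ ∞ F₀)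
    (heq : wt = fun x => -(∑ i, b i x * pd i w x) + Complex.I * ((ε : ℂ) / 2) * lapC w x + F₀ x)
    (hbd : ∀ i m, 1 ≤ m.length → m.length ≤ s → ∀ x, ‖dl m (b i) x‖ ≤ Λ)
    (hκ : ∀ m, m.length ≤ s → L2le (dl m F₀) κ) {l : List (Fin 3)} (hl : l.length ≤ s) :
    L2le (forcing b ε (dl l w) (dl l wt)) (κ + 3 * 2 ^ s * Λ * sobNorm s w) := by
  rw [forcing_dl hb hw.contDiff hF heq]
  have hW := sobNorm_nonneg s w
  have h1 : ∀ i, L2le (fun x => ((splitsTail l).map fun p =>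
      dl p.1 (b i) x * dl p.2 (pd i w) x).sum) (2 ^ s * (Λ * sobNorm s w)) := by
    intro i
    have h2 := L2le.list_sum (splitsTail l) (f := fun p x => dl p.1 (b i) x * dl p.2 (pd i w) x)
      (c := Λ * sobNorm s w) fun p hp => by
        obtain ⟨hp1, hp2⟩ := splitsTail_length p hp
        refine L2le.bdd_mul ?_ (contDiff_dl (hb i) _).continuous.aestronglyMeasurable
          (hbd i p.1 hp1 (by omega))
        rw [dl_pd hw.contDiff]
        exact IsSchwartzF.L2le_dl (l := i :: p.2) hw (by simp; omega)
    refine h2.mono (mul_le_mul_of_nonneg_right ?_ (by positivity))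
    have h3 := length_splits l
    rw [splits, List.length_cons] at h3
    have h4 : 2 ^ l.length ≤ 2 ^ s := Nat.pow_le_pow_right (by norm_num) hl
    exact_mod_cast (by omega : (splitsTail l).length ≤ 2 ^ s)
  exact ((hκ l hl).sub (L2le.sum3 h1)).mono (by linarith)

lemma L2le_sum3_mul {Λ W : ℝ} {g f : Fin 3 → E3 → ℂ} (hg : ∀ i, Continuous (g i))
    (hgb : ∀ i x, ‖g i x‖ ≤ Λ) (hf : ∀ i, L2le (f i) W) :
    L2le (fun x => ∑ i, g i x * f i x) (3 * (Λ * W)) :=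
  L2le.sum3 fun i => (hf i).bdd_mul (hg i).aestronglyMeasurable (hgb i)

lemma L2le_forcing_dq {s : ℕ} {Λ κ : ℝ} (hΛ : 0 ≤ Λ) (hb : ∀ i, ContDiff ℝ ∞ (b i))
    (hw : IsSchwartzF w) (hwt : ContDiff ℝ ∞ wt) (hF : ContDiff ℝ ∞ F₀)
    (heq : wt = fun x => -(∑ i, b i x * pd i w x) + Complex.I * ((ε : ℂ) / 2) * lapC w x + F₀ x)
    (hbd : ∀ i m, 1 ≤ m.length → m.length ≤ s → ∀ x, ‖dl m (b i) x‖ ≤ Λ)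
    (hκ : ∀ m, m.length ≤ s → L2le (dl m F₀) κ) {l : List (Fin 3)} {j : Fin 3}
    (hl : (j :: l).length ≤ s) {h : ℝ} (hh : h ≠ 0) :
    L2le (forcing b ε (dq h j (dl l w)) (dq h j (dl l wt)))
      (κ + 3 * 2 ^ s * Λ * sobNorm s w + 6 * Λ * sobNorm s w) := by
  have hu := contDiff_dl hw.contDiff l
  have hut := contDiff_dl hwt l
  have hbj : ∀ i x, ‖pd j (b i) x‖ ≤ Λ :=
    fun i => hbd i [j] (by simp) (by simp at hl ⊢; omega)
  have hpu : ∀ i, L2le (pd i (dl l w)) (sobNorm s w) :=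
    fun i => IsSchwartzF.L2le_dl (l := i :: l) hw hl
  rw [forcing_dq hu]
  have h1 : L2le (pd j (forcing b ε (dl l w) (dl l wt)))
      (κ + 3 * 2 ^ s * Λ * sobNorm s w + 3 * (Λ * sobNorm s w)) := by
    rw [pd_forcing hb hu hut]
    exact (L2le_forcing_dl (l := j :: l) hΛ hb hw hF heq hbd hκ hl).add
      (L2le_sum3_mul (fun i => (contDiff_pd (hb i) j).continuous) hbj hpu)
  have h2 := L2le.dq (contDiff_forcing hb hu hut) hh h1
  have h3 := L2le_sum3_mul (fun i => (contDiff_dq (hb i) h j).continuous)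
    (fun i => norm_dq_le (hb i) hh (hbj i)) (fun i => (hpu i).translate (h • e3 j))
  exact (h2.sub h3).mono (by linarith)

end

/-- Bounds for the source term in the equation satisfied by the difference of amplitudes. -/
lemma exists_source_const (s : ℕ) (hs : 2 ≤ s) (B : ℝ) (hB : 1 ≤ B) : ∃ C : ℝ, 0 < C ∧
    ∀ {ε Λ : ℝ} {Φ w a aε : E3 → ℂ} {K : E3 → ℝ}, 0 < ε → 1 ≤ Λ → ContDiff ℝ ∞ Φ →
    (∀ m : List (Fin 3), 2 ≤ m.length → m.length ≤ s + 2 → ∀ x, ‖dl m Φ x‖ ≤ Λ) →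
    IsSchwartzF w → IsSchwartzF a → IsSchwartzF aε → sobNorm (s + 2) a ≤ B → sobNorm s aε ≤ B →
    Integrable K → ε⁻¹ * (∫ x, |K x|) ≤ Λ * ε →
    ∀ F₀ : E3 → ℂ, (F₀ = fun x => (-(1 / 2 : ℂ)) * (w x * lapC Φ x) +
      Complex.I * ((ε : ℂ) / 2) * lapC a x - Complex.I * (ε : ℂ)⁻¹ *
        ((conv3 K (fun y => ‖aε y‖ ^ 2) x : ℂ) * aε x)) →
    ContDiff ℝ ∞ F₀ ∧ ∀ m : List (Fin 3), m.length ≤ s →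
      L2le (dl m F₀) (C * Λ * (sobNorm s w + ε)) := by
  obtain ⟨C, hC0, hC⟩ := exists_trilinear_const s hs B hB
  refine ⟨3 * 2 ^ s + 2 * B + C, by positivity, ?_⟩
  intro ε Λ Φ w a aε K hε hΛ hΦ hΦb hw ha haε haB haεB hK hKε F₀ hF₀
  obtain ⟨hN, hNl⟩ := hC K hK aε haε haεB
  have hNs : ContDiff ℝ ∞ fun x => (conv3 K (fun y => ‖aε y‖ ^ 2) x : ℂ) * aε x :=
    hN.mul haε.contDiff
  have hL := contDiff_lapC hΦ
  have hwL : ContDiff ℝ ∞ fun x => w x * lapC Φ x := hw.contDiff.mul hL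
  have hLa := contDiff_lapC ha.contDiff
  have h1 : ContDiff ℝ ∞ fun x => (-(1 / 2 : ℂ)) * (w x * lapC Φ x) := contDiff_const.mul hwL
  have h2 : ContDiff ℝ ∞ fun x => Complex.I * ((ε : ℂ) / 2) * lapC a x := contDiff_const.mul hLa
  have h3 : ContDiff ℝ ∞ fun x => Complex.I * (ε : ℂ)⁻¹ *
      ((conv3 K (fun y => ‖aε y‖ ^ 2) x : ℂ) * aε x) := contDiff_const.mul hNs
  have hW := sobNorm_nonneg s w
  have hΛ0 : 0 ≤ Λ := by linarith
  subst hF₀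
  refine ⟨(h1.add h2).sub h3, fun m hm => ?_⟩
  rw [dl_sub (h1.add h2) h3, dl_add h1 h2, dl_const_mul hwL, dl_const_mul hLa, dl_const_mul hNs]
  have b1 : L2le (dl m fun x => w x * lapC Φ x) (2 ^ s * (3 * Λ * sobNorm s w)) := by
    have hcomm : (fun x => w x * lapC Φ x) = fun x => lapC Φ x * w x := by
      funext x; ring
    rw [hcomm, dl_mul' hL hw.contDiff]
    have h2 := L2le.list_sum (splits m) (f := fun p x => dl p.1 (lapC Φ) x * dl p.2 w x)
      (c := 3 * Λ * sobNorm s w) fun p hp => by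
        have hp2 := splits_length p hp
        refine L2le.bdd_mul (IsSchwartzF.L2le_dl hw (by omega))
          (contDiff_dl hL _).continuous.aestronglyMeasurable fun x => ?_
        rw [dl_lapC hΦ]
        have h5 : ∀ i : Fin 3, ‖pd i (pd i (dl p.1 Φ)) x‖ ≤ Λ := fun i =>
          hΦb (i :: i :: p.1) (by simp) (by simp; omega) x
        refine (norm_sum_le_of_le _ fun i _ => h5 i).trans ?_
        simp
    refine h2.mono (mul_le_mul_of_nonneg_right ?_ (by positivity))
    rw [length_splits]
    push_cast
    exact pow_le_pow_right₀ (by norm_num) hm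
  have b2 : L2le (dl m (lapC a)) (3 * B) := by
    rw [dl_lapC ha.contDiff]
    refine L2le.sum3 fun i => (IsSchwartzF.L2le_dl (s := s + 2) (l := i :: i :: m) ha ?_).mono haB
    simp; omega
  have b3 := hNl m hm
  have n1 : ‖(-(1 / 2 : ℂ))‖ = 1 / 2 := by simp
  have n2 : ‖Complex.I * ((ε : ℂ) / 2)‖ = ε / 2 := by
    simp [abs_of_pos hε]
  have n3 : ‖Complex.I * (ε : ℂ)⁻¹‖ = ε⁻¹ := by
    simp [abs_of_pos hε]
  refine (((b1.const_mul _).add (b2.const_mul _)).sub (b3.const_mul _)).mono ?_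
  rw [n1, n2, n3]
  have k1 : ε⁻¹ * (C * ∫ x, |K x|) ≤ C * (Λ * ε) := by
    have := mul_le_mul_of_nonneg_left hKε hC0.le
    linarith
  have k2 : B * ε ≤ B * Λ * ε := by
    have : 0 ≤ B * ε := by positivity
    nlinarith
  have k3 : 0 ≤ 2 ^ s * Λ * sobNorm s w := by positivity
  have k4 : 0 ≤ 2 ^ s * Λ * ε := by positivity
  have k5 : 0 ≤ B * Λ * sobNorm s w := by positivity
  have k6 : 0 ≤ C * Λ * sobNorm s w := by positivity
  have k7 : 0 ≤ B * Λ * ε := by positivity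
  nlinarith

lemma STSmooth.dq {T : ℝ} {U : ℝ → E3 → ℂ} (hU : STSmooth T U) (h : ℝ) (j : Fin 3) :
    STSmooth T (fun t => dq h j (U t)) :=
  ((hU.translate (h • e3 j)).sub hU).const_mul _

lemma HasDerivAt.dq {U : ℝ → E3 → ℂ} {Ut : E3 → ℂ} {t : ℝ}
    (hU : ∀ x, HasDerivAt (fun τ => U τ x) (Ut x) t) (h : ℝ) (j : Fin 3) (x : E3) :
    HasDerivAt (fun τ => _root_.dq h j (U τ) x) (_root_.dq h j Ut x) t :=
  ((hU _).sub (hU x)).const_mul _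

/-- A bootstrap form of Gronwall's inequality. -/
lemma le_of_bootstrap {W : ℝ → ℝ} {r T N ε : ℝ} (hT : 0 ≤ T) (hr0 : 0 < r) (hε : 0 ≤ ε)
    (hW0 : ∀ t, 0 ≤ W t) (hwN : ∀ t ∈ Icc 0 T, W t ≤ N)
    (step : ∀ Q : ℝ, 0 ≤ Q → (∀ t ∈ Icc 0 T, W t ^ 2 ≤ Q * exp (r * t)) →
      ∀ t ∈ Icc 0 T, W t ^ 2 ≤ W 0 ^ 2 + (Q + ε ^ 2) / 2 * exp (r * t)) :
    ∀ t ∈ Icc 0 T, W t ≤ 2 * exp (r * T) * (W 0 + ε) := by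
  have h0 : (0 : ℝ) ∈ Icc 0 T := ⟨le_rfl, hT⟩
  set S := (fun t => W t ^ 2 * exp (-(r * t))) '' Icc 0 T with hS
  have hexp : ∀ t, exp (-(r * t)) * exp (r * t) = 1 := fun t => by
    rw [← exp_add]; simp
  have hbdd : BddAbove S := by
    refine ⟨N ^ 2, ?_⟩
    rintro _ ⟨t, ht, rfl⟩
    have h1 : exp (-(r * t)) ≤ 1 := exp_le_one_iff.2 (by linarith [mul_nonneg hr0.le ht.1])
    have h2 : W t ^ 2 ≤ N ^ 2 := pow_le_pow_left₀ (hW0 t) (hwN t ht) 2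
    calc W t ^ 2 * exp (-(r * t)) ≤ N ^ 2 * 1 := by gcongr
      _ = N ^ 2 := mul_one _
  have hWS : ∀ t ∈ Icc 0 T, W t ^ 2 ≤ sSup S * exp (r * t) := by
    intro t ht
    have h1 := mul_le_mul_of_nonneg_right (le_csSup hbdd ⟨t, ht, rfl⟩) (exp_pos (r * t)).le
    simp only [mul_assoc, hexp, mul_one] at h1
    exact h1
  have hS0 : 0 ≤ sSup S := by
    have := hWS 0 h0
    simp only [mul_zero, exp_zero, mul_one] at this
    exact (sq_nonneg _).trans this
  have hstep := step _ hS0 hWS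
  have hSle : sSup S ≤ W 0 ^ 2 + (sSup S + ε ^ 2) / 2 := by
    refine csSup_le ⟨_, 0, h0, rfl⟩ ?_
    rintro _ ⟨t, ht, rfl⟩
    have h1 := mul_le_mul_of_nonneg_right (hstep t ht) (exp_pos (-(r * t))).le
    have h2 : exp (-(r * t)) ≤ 1 := exp_le_one_iff.2 (by linarith [mul_nonneg hr0.le ht.1])
    have h3 : W 0 ^ 2 * exp (-(r * t)) ≤ W 0 ^ 2 * 1 := by gcongr
    have h4 : (sSup S + ε ^ 2) / 2 * exp (r * t) * exp (-(r * t)) = (sSup S + ε ^ 2) / 2 := by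
      rw [mul_assoc, mul_comm (exp (r * t)), hexp, mul_one]
    rw [add_mul, h4] at h1
    linarith
  intro t ht
  have hWε : 0 ≤ W 0 + ε := add_nonneg (hW0 0) hε
  refine (sq_le_sq₀ (hW0 t) (by positivity)).1 ?_
  have h1 : 1 ≤ exp (r * T) := one_le_exp (by positivity)
  have h2 : exp (r * t) ≤ exp (r * T) := exp_le_exp.2 (by gcongr; exact ht.2)
  have h3 : sSup S ≤ 2 * (W 0 + ε) ^ 2 := by
    nlinarith [mul_nonneg (hW0 0) hε, sq_nonneg ε]
  calc W t ^ 2 ≤ sSup S * exp (r * t) := hWS t ht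
    _ ≤ 2 * (W 0 + ε) ^ 2 * exp (r * T) := by gcongr
    _ ≤ (2 * (W 0 + ε) ^ 2 * exp (r * T)) * (2 * exp (r * T)) :=
        le_mul_of_one_le_right (by positivity) (by linarith)
    _ = (2 * exp (r * T) * (W 0 + ε)) ^ 2 := by ring

set_option maxHeartbeats 800000 in
/-- Gronwall-type bound for the `H^s` norm in the equation `∂_t w + b·∇w = i(ε/2)Δw + F₀`. -/
lemma exists_sobolev_energy_const (s : ℕ) (hs : 1 ≤ s) (T Λ C₁ : ℝ) (hT : 0 < T) (hΛ : 1 ≤ Λ)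
    (hC₁ : 0 ≤ C₁) : ∃ A : ℝ, 0 < A ∧ ∀ {ε M N : ℝ} {b : ℝ → Fin 3 → E3 → ℂ} {w F₀ : ℝ → E3 → ℂ},
    0 ≤ ε → 0 ≤ M → STSmooth T w → (∀ t ∈ Icc 0 T, IsSchwartzF (w t)) →
    (∀ t ∈ Icc 0 T, sobNorm s (w t) ≤ N) →
    (∀ t ∈ Icc 0 T, ∀ i, ContDiff ℝ ∞ (b t i)) →
    (∀ t ∈ Icc 0 T, ∀ i x, (starRingEnd ℂ) (b t i x) = b t i x) →
    (∀ t ∈ Icc 0 T, ∀ i x, ‖b t i x‖ ≤ M + 3 * Λ * ‖x‖) →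
    (∀ t ∈ Icc 0 T, ∀ i (m : List (Fin 3)), 1 ≤ m.length → m.length ≤ s →
      ∀ x, ‖dl m (b t i) x‖ ≤ Λ) →
    (∀ t ∈ Icc 0 T, tder T w t = fun x => -(∑ i, b t i x * pd i (w t) x) +
      Complex.I * ((ε : ℂ) / 2) * lapC (w t) x + F₀ t x) →
    (∀ t ∈ Icc 0 T, ContDiff ℝ ∞ (F₀ t)) →
    (∀ t ∈ Icc 0 T, ∀ m : List (Fin 3), m.length ≤ s →
      L2le (dl m (F₀ t)) (C₁ * Λ * (sobNorm s (w t) + ε))) →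
    ∀ t ∈ Icc 0 T, sobNorm s (w t) ≤ A * (sobNorm s (w 0) + ε) := by
  obtain ⟨C, hC0, hC⟩ := exists_energy_const
  set c := C₁ * Λ + 3 * 2 ^ s * Λ + 6 * Λ with hc
  have hΛ0 : 0 ≤ Λ := by linarith
  have hc0 : 0 < c := by positivity
  set A₀ := C * Λ + 2 * c ^ 2 with hA₀
  have hA₀0 : 0 < A₀ := by positivity
  set r := 2 * (mIdx s).card * A₀ + 1 with hr
  have hr0 : 0 < r := by positivity
  refine ⟨2 * exp (r * T), by positivity, ?_⟩
  intro ε M N b w F₀ hε hM hwST hwS hwN hb hbr hbM hbΛ heq hF hFκ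
  have h0 : (0 : ℝ) ∈ Icc 0 T := ⟨le_rfl, hT.le⟩
  set W := fun t => sobNorm s (w t) with hW
  have hW0 : ∀ t, 0 ≤ W t := fun t => sobNorm_nonneg s _
  have hN0 : 0 ≤ N := (hW0 0).trans (hwN 0 h0)
  set f := fun t => c * (W t + ε) with hf
  have htST := hwST.tder hT
  have step : ∀ Q : ℝ, 0 ≤ Q → (∀ t ∈ Icc 0 T, W t ^ 2 ≤ Q * exp (r * t)) →
      ∀ t ∈ Icc 0 T, W t ^ 2 ≤ W 0 ^ 2 + (Q + ε ^ 2) / 2 * exp (r * t) := by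
    intro Q hQ hWQ
    set P := A₀ * (Q + ε ^ 2) with hP
    have hP0 : 0 ≤ P := by positivity
    have base : ∀ (v vt : ℝ → E3 → ℂ) (N' : ℝ), STSmooth T v → STSmooth T vt →
        (∀ t ∈ Ioo 0 T, ∀ x, HasDerivAt (fun τ => v τ x) (vt t x) t) →
        (∀ t ∈ Icc 0 T, L2le (v t) (W t)) → (∀ t ∈ Icc 0 T, ∀ i, L2le (pd i (v t)) N') →
        (∀ t ∈ Icc 0 T, L2le (forcing (b t) ε (v t) (vt t)) (f t)) →
        ∀ t ∈ Icc 0 T, ∫ x, ‖v t x‖ ^ 2 ≤ (∫ x, ‖v 0 x‖ ^ 2) + P / r * exp (r * t) := by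
      intro v vt N' hv hvt hder hvW hpv hforce
      have hsub := fun (t : ℝ) (ht : t ∈ Ioo 0 T) => Ioo_subset_Icc_self ht
      refine hC (M := M) (N := max N N') (b := b) (vt := vt) (f := f)
        (F := fun t => forcing (b t) ε (v t) (vt t)) hε hΛ hM hP0 hr0 hv.continuousOn
        hvt.continuousOn hder (fun t ht => hv.slice ht) (fun t ht => hb t (hsub t ht))
        (fun t ht => hbr t (hsub t ht)) (fun t ht => hbM t (hsub t ht)) (fun t ht x => ?_)
        (fun t ht => (contDiff_forcing (hb t (hsub t ht)) (hv.slice (hsub t ht))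
          (hvt.slice (hsub t ht))).continuous) (fun t ht x => ?_)
        (fun t ht => (hvW t ht).mono ((hwN t ht).trans (le_max_left _ _)))
        (fun t ht i => (hpv t (hsub t ht) i).mono (le_max_right _ _))
        (fun t ht => hforce t (hsub t ht)) (fun t ht => ?_)
      · refine (norm_sum_le_of_le _ fun i _ =>
          hbΛ t (hsub t ht) i [i] (by simp) (by simpa using hs) x).trans ?_
        simp
      · simp only [forcing]; ring
      · have h1 := (hvW t (hsub t ht)).integral_le
        have h2 := hWQ t (hsub t ht)
        have h3 : 1 ≤ exp (r * t) := one_le_exp (mul_nonneg hr0.le ht.1.le)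
        have h4 : f t ^ 2 ≤ 2 * c ^ 2 * (W t ^ 2 + ε ^ 2) := by
          have : 0 ≤ c ^ 2 * (W t - ε) ^ 2 := by positivity
          simp only [hf]; nlinarith
        have h5 : C * Λ * (∫ x, ‖v t x‖ ^ 2) ≤ C * Λ * W t ^ 2 := by gcongr
        have h6 : 0 ≤ C * Λ * ε ^ 2 := by positivity
        have h7 : W t ^ 2 + ε ^ 2 ≤ (Q + ε ^ 2) * exp (r * t) := by nlinarith [sq_nonneg ε]
        calc C * Λ * (∫ x, ‖v t x‖ ^ 2) + f t ^ 2 ≤ A₀ * (W t ^ 2 + ε ^ 2) := by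
              rw [hA₀]; nlinarith
          _ ≤ A₀ * ((Q + ε ^ 2) * exp (r * t)) := by gcongr
          _ = P * exp (r * t) := by rw [hP]; ring
    have hdl : ∀ l : List (Fin 3), l.length ≤ s → ∀ t ∈ Icc 0 T,
        ∫ x, ‖dl l (w t) x‖ ^ 2 ≤ (∫ x, ‖dl l (w 0) x‖ ^ 2) + P / r * exp (r * t) := by
      intro l hl
      have hforce : ∀ t ∈ Icc 0 T, ∀ l : List (Fin 3), l.length ≤ s →
          L2le (forcing (b t) ε (dl l (w t)) (dl l (tder T w t))) (f t) := by
        intro t ht l hl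
        refine (L2le_forcing_dl hΛ0 (hb t ht) (hwS t ht) (hF t ht) (heq t ht) (hbΛ t ht)
          (hFκ t ht) hl).mono ?_
        have : 0 ≤ (3 * 2 ^ s * Λ + 6 * Λ) * ε := by positivity
        have : 0 ≤ 6 * Λ * W t := mul_nonneg (by positivity) (hW0 t)
        simp only [hf, hc, hW] at *
        nlinarith
      cases l with
      | nil =>
        refine base w (tder T w) N hwST htST (fun t ht x => hwST.hasDerivAt hT ht x)
          (fun t ht => IsSchwartzF.L2le_dl (l := []) (hwS t ht) (by simp))
          (fun t ht i => (IsSchwartzF.L2le_dl (l := [i]) (hwS t ht) (by simpa using hs)).mono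
            (hwN t ht)) (fun t ht => hforce t ht [] (by simp))
      | cons j l =>
        have hl' : l.length ≤ s := by simp at hl; omega
        intro t ht
        have hpj : ∀ t ∈ Icc 0 T, L2le (pd j (dl l (w t))) (W t) := fun t ht =>
          IsSchwartzF.L2le_dl (l := j :: l) (hwS t ht) hl
        set D := √((∫ x, ‖dl (j :: l) (w 0) x‖ ^ 2) + P / r * exp (r * t)) with hD
        have hI0 : ∀ u : E3 → ℂ, 0 ≤ ∫ x, ‖u x‖ ^ 2 := fun u =>
          integral_nonneg fun x => by positivity
        have hDsq : D ^ 2 = (∫ x, ‖dl (j :: l) (w 0) x‖ ^ 2) + P / r * exp (r * t) :=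
          sq_sqrt (add_nonneg (hI0 _) (by positivity))
        rw [← hDsq]
        refine (L2le.of_dq (contDiff_dl (hwS t ht).contDiff l) fun h hh => ?_).integral_le
        have hbase := base (fun t => dq h j (dl l (w t))) (fun t => dq h j (dl l (tder T w t)))
          (‖(h : ℂ)⁻¹‖ * (N + N)) ((hwST.dl hT l).dq h j) ((htST.dl hT l).dq h j)
          (fun t ht x => HasDerivAt.dq (fun x => by
            have := (hwST.dl hT l).hasDerivAt hT ht x
            rwa [hwST.tder_dl hT l (Ioo_subset_Icc_self ht)] at this) h j x)
          (fun t ht => (hpj t ht).dq (contDiff_dl (hwS t ht).contDiff l) hh.ne')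
          (fun t ht i => by
            have h1 : L2le (pd i (dl l (w t))) N :=
              (IsSchwartzF.L2le_dl (l := i :: l) (hwS t ht) hl).mono (hwN t ht)
            rw [pd_dq (contDiff_dl (hwS t ht).contDiff l)]
            exact ((h1.translate (h • e3 j)).sub h1).const_mul _)
          (fun t ht => by
            refine (L2le_forcing_dq hΛ0 (hb t ht) (hwS t ht) (htST.slice ht) (hF t ht) (heq t ht)
              (hbΛ t ht) (hFκ t ht) hl hh.ne').mono ?_
            have : 0 ≤ (3 * 2 ^ s * Λ + 6 * Λ) * ε := by positivity
            simp only [hf, hc, hW] at *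
            nlinarith) t ht
        refine L2le.of_integral ((hpj t ht).dq (contDiff_dl (hwS t ht).contDiff l) hh.ne').memLp
          (sqrt_nonneg _) ?_
        rw [hDsq]
        refine hbase.trans (add_le_add_left ?_ _)
        have h2 : L2le (pd j (dl l (w 0))) √(∫ x, ‖dl (j :: l) (w 0) x‖ ^ 2) :=
          L2le.of_integral (hpj 0 h0).memLp (sqrt_nonneg _) (by rw [sq_sqrt (hI0 _)]; rfl)
        have h3 := (h2.dq (contDiff_dl (hwS 0 h0).contDiff l) hh.ne').integral_le
        rwa [sq_sqrt (hI0 _)] at h3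
    intro t ht
    have h1 : W t ^ 2 ≤ W 0 ^ 2 + (mIdx s).card * (P / r * exp (r * t)) := by
      simp only [hW, sobNorm_sq]
      rw [← nsmul_eq_mul, ← Finset.sum_const, ← Finset.sum_add_distrib]
      refine Finset.sum_le_sum fun σ hσ => hdl _ ?_ t ht
      rw [length_mword]
      exact mem_mIdx.1 hσ
    have h2 : (mIdx s).card * (P / r) ≤ (Q + ε ^ 2) / 2 := by
      have h3 : (mIdx s).card * (P / r) = ((mIdx s).card * A₀ / r) * (Q + ε ^ 2) := by
        rw [hP]; ring
      have h4 : (mIdx s).card * A₀ / r ≤ 1 / 2 := by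
        rw [div_le_iff₀ hr0, hr]; linarith
      rw [h3]
      have := mul_le_mul_of_nonneg_right h4 (by positivity : 0 ≤ Q + ε ^ 2)
      linarith
    have h3 := mul_le_mul_of_nonneg_right h2 (exp_pos (r * t)).le
    linarith
  exact le_of_bootstrap hT.le hr0 hε hW0 hwN step

lemma norm_fderiv_le_of_pd {g : E3 → ℂ} {Λ : ℝ} {x : E3} (hg : ∀ i, ‖pd i g x‖ ≤ Λ) :
    ‖fderiv ℝ g x‖ ≤ 3 * Λ := by
  have hΛ : 0 ≤ Λ := (norm_nonneg _).trans (hg 0)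
  refine ContinuousLinearMap.opNorm_le_bound _ (by positivity) fun v => ?_
  have hv : v = ∑ i, v i • e3 i := by
    ext j
    simp [e3, Fin.sum_univ_three]
    fin_cases j <;> simp
  have h1 : fderiv ℝ g x v = ∑ i, v i • pd i g x := by
    conv_lhs => rw [hv]
    simp only [map_sum, map_smul, pd]
  rw [h1]
  have h2 : ∀ i, ‖v i • pd i g x‖ ≤ Λ * ‖v‖ := fun i => by
    rw [norm_smul, mul_comm]
    exact mul_le_mul (hg i) (PiLp.norm_apply_le v i) (norm_nonneg _) hΛ
  refine (norm_sum_le_of_le _ fun i _ => h2 i).trans ?_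
  simp [mul_assoc]

lemma norm_le_of_pd {g : E3 → ℂ} (hg : ContDiff ℝ ∞ g) {Λ : ℝ} (hb : ∀ i x, ‖pd i g x‖ ≤ Λ)
    (x : E3) : ‖g x‖ ≤ ‖g 0‖ + 3 * Λ * ‖x‖ := by
  have h1 := convex_univ.norm_image_sub_le_of_norm_fderiv_le (𝕜 := ℝ) (f := g) (C := 3 * Λ)
    (fun y _ => hg.diffble y) (fun y _ => norm_fderiv_le_of_pd fun i => hb i y)
    (mem_univ 0) (mem_univ x)
  rw [sub_zero] at h1
  linarith [norm_le_insert' (g x) (g 0)]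

/-- The gradient of a phase with bounded second derivatives grows at most linearly. -/
lemma exists_linear_growth {T Λ : ℝ} (hT : 0 < T) {Φ : ℝ → E3 → ℂ} (hΦ : STSmooth T Φ)
    (hb : ∀ t ∈ Icc 0 T, ∀ i j x, ‖pd j (pd i (Φ t)) x‖ ≤ Λ) :
    ∃ M : ℝ, 0 ≤ M ∧ ∀ t ∈ Icc 0 T, ∀ i x, ‖pd i (Φ t) x‖ ≤ M + 3 * Λ * ‖x‖ := by
  have h1 : ∀ i, ∃ M, ∀ t ∈ Icc 0 T, ‖pd i (Φ t) 0‖ ≤ M := fun i => by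
    refine isCompact_Icc.exists_bound_of_continuousOn ?_
    exact (hΦ.pd hT i).continuousOn.comp (f := fun t : ℝ => (t, (0 : E3))) (by fun_prop)
      fun t ht => ⟨ht, mem_univ _⟩
  choose M hM using h1
  refine ⟨∑ i, |M i|, Finset.sum_nonneg fun i _ => abs_nonneg _, fun t ht i x => ?_⟩
  have h2 := norm_le_of_pd ((hΦ.pd hT i).slice ht) (hb t ht i) x
  have h3 := (hM i t ht).trans (le_abs_self _)
  have h4 := Finset.single_le_sum (f := fun i => |M i|) (fun i _ => abs_nonneg _)
    (Finset.mem_univ i)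
  linarith

/-- **Convergence of the WKB amplitude in the subcritical (semiclassical Gross–Pitaevskii)
regime `κ = 0`.**  If `a^ε` solves the amplitude equation with a nonnegative convolution
potential `K` satisfying `ε⁻¹‖K‖_{L¹} ≤ Λε`, and `a` solves the free transport equation
`∂_t a + ∇φ_eik·∇a + (1/2)aΔφ_eik = 0`, then
`sup_{t∈[0,T₀]} ‖a^ε(t) - a(t)‖_{H^s} ≤ C(‖a^ε(0) - a(0)‖_{H^s} + ε)`. -/
theorem wkb_amplitude_convergence_subcritical
    (s : ℕ) (hs : 2 ≤ s) (T₀ Λ B : ℝ)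
    (hT₀ : 0 < T₀) (hΛ : 1 ≤ Λ) (hB : 1 ≤ B) :
    ∃ C > (0 : ℝ),
      ∀ ε : ℝ, 0 < ε → ε ≤ 1 →
      ∀ φeik : ℝ → E3 → ℝ,
        (∀ n : ℕ, ContDiffOn ℝ n (fun p : ℝ × E3 => φeik p.1 p.2)
          (Set.Icc 0 T₀ ×ˢ Set.univ)) →
        (∀ σ : Fin 3 → ℕ, 2 ≤ mdeg σ → mdeg σ ≤ s + 2 →
          ∀ t ∈ Set.Icc (0 : ℝ) T₀, ∀ x, |mpdR σ (φeik t) x| ≤ Λ) →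
      ∀ K : E3 → ℝ, Integrable K → (∀ x, 0 ≤ K x) →
        ε⁻¹ * (∫ x : E3, |K x|) ≤ Λ * ε →
      ∀ aε : ℝ → E3 → ℂ,
        (∀ n : ℕ, ContDiffOn ℝ n (fun p : ℝ × E3 => aε p.1 p.2)
          (Set.Icc 0 T₀ ×ˢ Set.univ)) →
        (∀ t ∈ Set.Icc (0 : ℝ) T₀, IsSchwartzF (aε t)) →
        (∀ t ∈ Set.Icc (0 : ℝ) T₀, ∀ x : E3,
          derivWithin (fun τ => aε τ x) (Set.Icc 0 T₀) t
            + (∑ i : Fin 3, (pdR i (φeik t) x : ℂ) * pd i (aε t) x)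
            + (1 / 2 : ℂ) * aε t x * (lapR (φeik t) x : ℂ)
          = Complex.I * ((ε : ℂ) / 2) * lapC (aε t) x
            - Complex.I * (ε : ℂ)⁻¹ *
                (conv3 K (fun y => ‖aε t y‖ ^ 2) x : ℂ) * aε t x) →
        (∀ t ∈ Set.Icc (0 : ℝ) T₀, sobNorm s (aε t) ≤ B) →
      ∀ a : ℝ → E3 → ℂ,
        (∀ n : ℕ, ContDiffOn ℝ n (fun p : ℝ × E3 => a p.1 p.2)
          (Set.Icc 0 T₀ ×ˢ Set.univ)) →
        (∀ t ∈ Set.Icc (0 : ℝ) T₀, IsSchwartzF (a t)) →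
        (∀ t ∈ Set.Icc (0 : ℝ) T₀, ∀ x : E3,
          derivWithin (fun τ => a τ x) (Set.Icc 0 T₀) t
            + (∑ i : Fin 3, (pdR i (φeik t) x : ℂ) * pd i (a t) x)
            + (1 / 2 : ℂ) * a t x * (lapR (φeik t) x : ℂ) = 0) →
        (∀ t ∈ Set.Icc (0 : ℝ) T₀, sobNorm (s + 2) (a t) ≤ B) →
      ∀ t ∈ Set.Icc (0 : ℝ) T₀,
        sobNorm s (fun x => aε t x - a t x) ≤
          C * (sobNorm s (fun x => aε 0 x - a 0 x) + ε) := by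
  obtain ⟨C₁, hC₁, hsource⟩ := exists_source_const s hs B hB
  obtain ⟨A, hA, henergy⟩ :=
    exists_sobolev_energy_const s (by omega) T₀ Λ C₁ hT₀ hΛ hC₁.le
  refine ⟨A, hA, ?_⟩
  intro ε hε _ φ hφ hφb K hK _ hKε aε haε haεS haεeq haεB a ha haS haeq haB
  set Φ : ℝ → E3 → ℂ := fun t x => (φ t x : ℂ) with hΦdef
  have hΦ : STSmooth T₀ Φ := Complex.ofRealCLM.contDiff.comp_contDiffOn (contDiffOn_infty.2 hφ)
  have hφs : ∀ t ∈ Icc 0 T₀, ContDiff ℝ ∞ (φ t) := fun t ht =>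
    Complex.reCLM.contDiff.comp (hΦ.slice ht)
  have hpd : ∀ t ∈ Icc 0 T₀, ∀ i, pd i (Φ t) = fun x => (pdR i (φ t) x : ℂ) := fun t ht i =>
    pd_ofReal ((hφs t ht).differentiable (by simp)) i
  have hΦb : ∀ t ∈ Icc 0 T₀, ∀ m : List (Fin 3), 2 ≤ m.length → m.length ≤ s + 2 →
      ∀ x, ‖dl m (Φ t) x‖ ≤ Λ := by
    intro t ht m hm1 hm2 x
    rw [dl_eq_mpd (hΦ.slice ht), mpd_ofReal (hφs t ht), Complex.norm_real]
    exact hφb _ (by rwa [mdeg_count]) (by rwa [mdeg_count]) t ht x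
  have haε' : STSmooth T₀ aε := contDiffOn_infty.2 haε
  have ha' : STSmooth T₀ a := contDiffOn_infty.2 ha
  have haB' : ∀ t ∈ Icc 0 T₀, sobNorm s (a t) ≤ B := fun t ht =>
    (sobNorm_mono (by omega) _).trans (haB t ht)
  set w : ℝ → E3 → ℂ := fun t x => aε t x - a t x with hw
  have hwST : STSmooth T₀ w := haε'.sub ha'
  have hwS : ∀ t ∈ Icc 0 T₀, IsSchwartzF (w t) := fun t ht => (haεS t ht).sub (haS t ht)
  have hwN : ∀ t ∈ Icc 0 T₀, sobNorm s (w t) ≤ √(∑ σ ∈ mIdx s, (B + B) ^ 2) := by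
    intro t ht
    rw [← sqrt_sq (sobNorm_nonneg s (w t)), sobNorm_sq]
    refine Real.sqrt_le_sqrt (Finset.sum_le_sum fun σ hσ => ?_)
    have hl : (mword σ).length ≤ s := by rw [length_mword]; exact mem_mIdx.1 hσ
    have h1 := ((haεS t ht).L2le_dl hl).mono (haεB t ht)
    have h2 := ((haS t ht).L2le_dl hl).mono (haB' t ht)
    have h3 := (h1.sub h2).integral_le
    have h4 : dl (mword σ) (w t) = fun x => dl (mword σ) (aε t) x - dl (mword σ) (a t) x :=
      dl_sub (haεS t ht).contDiff (haS t ht).contDiff (mword σ)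
    rw [h4]
    exact h3
  obtain ⟨M, hM, hgrowth⟩ := exists_linear_growth hT₀ hΦ fun t ht i j x =>
    hΦb t ht [j, i] (by simp) (by simp) x
  set F₀ : ℝ → E3 → ℂ := fun t x => (-(1 / 2 : ℂ)) * (w t x * lapC (Φ t) x) +
    Complex.I * ((ε : ℂ) / 2) * lapC (a t) x - Complex.I * (ε : ℂ)⁻¹ *
      ((conv3 K (fun y => ‖aε t y‖ ^ 2) x : ℂ) * aε t x) with hF₀
  have hF := fun (t : ℝ) (ht : t ∈ Icc 0 T₀) => hsource hε hΛ (hΦ.slice ht) (hΦb t ht) (hwS t ht)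
    (haS t ht) (haεS t ht) (haB t ht) (haεB t ht) hK hKε (F₀ t) rfl
  refine henergy (ε := ε) (b := fun t i => pd i (Φ t)) (w := w) (F₀ := F₀) hε.le hM hwST hwS hwN
    (fun t ht i => (hΦ.pd hT₀ i).slice ht) (fun t ht i x => ?_) hgrowth
    (fun t ht i m hm1 hm2 x => ?_) (fun t ht => ?_) (fun t ht => (hF t ht).1)
    (fun t ht => (hF t ht).2)
  · simp only [hpd t ht, Complex.conj_ofReal]
  · have h1 : dl m (pd i (Φ t)) = dl (m ++ [i]) (Φ t) := by rw [dl_append]; rfl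
    rw [h1]
    exact hΦb t ht _ (by simp; omega) (by simp; omega) x
  · funext x
    have h1 := haεeq t ht x
    have h2 := haeq t ht x
    have h3 := haε'.tder_sub hT₀ ha' ht x
    have e1 : ∀ i, pd i (w t) x = pd i (aε t) x - pd i (a t) x := fun i =>
      congrFun (pd_sub (haεS t ht).contDiff.diffble (haS t ht).contDiff.diffble i) x
    have e2 : lapC (w t) x = lapC (aε t) x - lapC (a t) x := by
      have e3 : ∀ i, pd i (pd i (w t)) x = pd i (pd i (aε t)) x - pd i (pd i (a t)) x := fun i =>
        congrFun (dl_sub (haεS t ht).contDiff (haS t ht).contDiff [i, i]) x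
      simp only [lapC, e3, Finset.sum_sub_distrib]
    have e4 : lapC (Φ t) x = (lapR (φ t) x : ℂ) := lapC_ofReal (hφs t ht) x
    have e5 : tder T₀ w t x = tder T₀ aε t x - tder T₀ a t x := h3
    have hwx : w t x = aε t x - a t x := rfl
    rw [e5]
    simp only [hF₀, e1, e2, e4, hpd t ht, hwx, mul_sub, Finset.sum_sub_distrib]
    simp only [← tder.eq_1] at h1 h2
    linear_combination h1 - h2
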